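/- arXiv:1910.01893 — 2 statements merged into one kernel-verified Lean document; each statement's English description precedes it below -/
import Mathlib

section
/- Let D be the ring of integers of a real quadratic number field. Every column-row matrix over D, i.e., every 2×2 matrix of the form (xa, xb; ya, yb) with a, b, x, y in D, is a product of idempotent matrices over D. -/
open scoped IntermediateField

def IsIdemProd {R : Type*} [CommRing R] (M : Matrix (Fin 2) (Fin 2) R) : Prop :=
  ∃ l : List (Matrix (Fin 2) (Fin 2) R), (∀ T ∈ l, T * T = T) ∧ M = l.prod

theorem IsIdemProd.mul' {R : Type*} [CommRing R] {M N : Matrix (Fin 2) (Fin 2) R}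
    (hM : IsIdemProd M) (hN : IsIdemProd N) : IsIdemProd (M * N) := by
  obtain ⟨l, hl, rfl⟩ := hM
  obtain ⟨l', hl', rfl⟩ := hN
  refine ⟨l ++ l', ?_, by simp⟩
  intro T hT
  rcases List.mem_append.1 hT with h | h
  · exact hl T h
  · exact hl' T h

theorem IsIdemProd.of_idem {R : Type*} [CommRing R] {M : Matrix (Fin 2) (Fin 2) R}
    (hM : M * M = M) : IsIdemProd M :=
  ⟨[M], by simpa using hM, by simp⟩

theorem IsIdemProd.transpose' {R : Type*} [CommRing R] {M : Matrix (Fin 2) (Fin 2) R}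
    (hM : IsIdemProd M) : IsIdemProd M.transpose := by
  obtain ⟨l, hl, rfl⟩ := hM
  refine ⟨(l.map Matrix.transpose).reverse, ?_, Matrix.transpose_list_prod l⟩
  intro T hT
  simp only [List.mem_reverse, List.mem_map] at hT
  obtain ⟨S, hS, rfl⟩ := hT
  rw [← Matrix.transpose_mul, hl S hS]

/-- adjacency of rows: the determinant is a unit -/
def Adj2 {R : Type*} [CommRing R] (p q : R × R) : Prop := IsUnit (p.1 * q.2 - p.2 * q.1)

/-- rows connected to `(1, 0)` -/
def Rch {R : Type*} [CommRing R] (v : R × R) : Prop := Relation.ReflTransGen Adj2 ((1 : R), (0 : R)) v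

section rch
variable {R : Type*} [CommRing R]

theorem rch_step {p q : R × R} (h : Rch p) (h' : IsUnit (p.1 * q.2 - p.2 * q.1)) : Rch q :=
  Relation.ReflTransGen.tail h h'

theorem rch_one : Rch ((1 : R), (0 : R)) := Relation.ReflTransGen.refl

theorem rch_mat (a b c e : R) (hdet : IsUnit (a * e - b * c)) (h0 : Rch (a, b)) {v : R × R}
    (h : Rch v) : Rch (v.1 * a + v.2 * c, v.1 * b + v.2 * e) := by
  induction h with
  | refl => simpa using h0
  | tail _ hadj ih =>
    refine rch_step ih ?_
    have := hadj.mul hdet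
    convert this using 1
    simp only
    ring

theorem rch_01 : Rch ((0 : R), (1 : R)) := rch_step rch_one (by simp)

theorem rch_addR' {a b : R} (t : R) (h : Rch (a, b)) : Rch (a, b + t * a) := by
  have := rch_mat 1 t 0 1 (by simp) (rch_step rch_01 (by simp)) h
  convert this using 2 <;> simp; ring

theorem rch_addL' {a b : R} (t : R) (h : Rch (a, b)) : Rch (a + t * b, b) := by
  have := rch_mat 1 0 t 1 (by simp) rch_one h
  convert this using 2 <;> simp; ring

theorem rch_addR {a b : R} (t : R) : Rch (a, b + t * a) ↔ Rch (a, b) := by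
  refine ⟨fun h => ?_, rch_addR' t⟩
  have := rch_addR' (-t) h
  convert this using 2; ring

theorem rch_addL {a b : R} (t : R) : Rch (a + t * b, b) ↔ Rch (a, b) := by
  refine ⟨fun h => ?_, rch_addL' t⟩
  have := rch_addL' (-t) h
  convert this using 2; ring

theorem rch_congR {a b b' : R} (h : a ∣ b' - b) (hr : Rch (a, b')) : Rch (a, b) := by
  obtain ⟨t, ht⟩ := h
  rw [← rch_addR t]
  convert hr using 2
  linear_combination -ht

theorem rch_congL {a a' b : R} (h : b ∣ a' - a) (hr : Rch (a', b)) : Rch (a, b) := by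
  obtain ⟨t, ht⟩ := h
  rw [← rch_addL t]
  convert hr using 2
  linear_combination -ht

theorem rch_swap {a b : R} (h : Rch (a, b)) : Rch (b, a) := by
  have := rch_mat 0 1 1 0 (by simp) rch_01 h
  simpa using this

theorem rch_unitL' {a b : R} (u : Rˣ) (h : Rch (a, b)) : Rch (u * a, b) := by
  have := rch_mat (u : R) 0 0 1 (by simp) (rch_step rch_01 (by simp)) h
  convert this using 2 <;> simp; ring

theorem rch_unitL {a b : R} (u : Rˣ) : Rch (u * a, b) ↔ Rch (a, b) := by
  refine ⟨fun h => ?_, rch_unitL' u⟩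
  have := rch_unitL' u⁻¹ h
  simpa using this

theorem rch_unitR {a b : R} (u : Rˣ) : Rch (a, u * b) ↔ Rch (a, b) :=
  ⟨fun h => rch_swap ((rch_unitL u).1 (rch_swap h)), fun h => rch_swap ((rch_unitL u).2 (rch_swap h))⟩

theorem rch_map {S : Type*} [CommRing S] (f : R →+* S) {v : R × R} (h : Rch v) :
    Rch (f v.1, f v.2) := by
  induction h with
  | refl => simpa using rch_one
  | tail _ hadj ih =>
    refine rch_step ih ?_
    have := hadj.map f
    simpa using this

theorem rch_int_aux (k : ℕ) : ∀ n m : ℤ, m.natAbs ≤ k → IsCoprime n m → Rch (n, m) := by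
  induction k with
  | zero =>
    intro n m hm hc
    have : m = 0 := by omega
    subst this
    rw [isCoprime_zero_right] at hc
    obtain ⟨u, rfl⟩ := hc
    have := (rch_unitL u (a := (1 : ℤ)) (b := 0)).2 rch_one
    simpa using this
  | succ k ih =>
    intro n m hm hc
    by_cases hm0 : m = 0
    · exact ih n m (by simp [hm0]) hc
    · apply rch_swap
      have h1 : (n % m).natAbs ≤ k := by
        have h2 := Int.emod_nonneg n hm0
        have h3 := Int.emod_lt_abs n hm0
        rcases abs_cases m with h4 | h4 <;> omega
      have h2 : n % m = n + m * (-(n / m)) := by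
        have := Int.emod_add_mul_ediv n m
        linear_combination this
      refine rch_congR (b' := n % m) ⟨-(n / m), by rw [h2]; ring⟩ (ih _ _ h1 ?_)
      rw [h2]
      exact hc.symm.add_mul_left_right _

theorem rch_int {n m : ℤ} (h : IsCoprime n m) : Rch ((n : R), (m : R)) :=
  rch_map (Int.castRingHom R) (rch_int_aux _ n m le_rfl h)

/-- `(a b; 0 0)` is a product of idempotents -/
def SS (v : R × R) : Prop := IsIdemProd !![v.1, v.2; 0, 0]

theorem ss_mul {v : R × R} (h : SS v) (a b c e : R)
    (hT : !![a, b; c, e] * !![a, b; c, e] = !![a, b; c, e]) :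
    SS (v.1 * a + v.2 * c, v.1 * b + v.2 * e) := by
  have := IsIdemProd.mul' h (IsIdemProd.of_idem hT)
  unfold SS
  convert this using 1
  ext i j; fin_cases i <;> fin_cases j <;> simp [Matrix.mul_apply, Fin.sum_univ_two]

theorem ss_of_rch {v : R × R} (h : Rch v) : SS v := by
  induction h with
  | refl =>
    apply IsIdemProd.of_idem
    ext i j; fin_cases i <;> fin_cases j <;> simp [Matrix.mul_apply, Fin.sum_univ_two]
  | @tail p q _ hadj ih =>
    obtain ⟨u, hu⟩ := hadj
    have hu1 : (u : R) * (↑u⁻¹ : R) = 1 := by simp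
    set w : R := (↑u⁻¹ : R)
    rw [hu] at hu1
    have hq : q.1 * ((q.2 - p.2) * w) + q.2 * ((p.1 - q.1) * w) = 1 := by
      linear_combination hu1
    have hp : p.1 * ((q.2 - p.2) * w) + p.2 * ((p.1 - q.1) * w) = 1 := by
      linear_combination hu1
    generalize (q.2 - p.2) * w = x at hq hp
    generalize (p.1 - q.1) * w = y at hq hp
    have := ss_mul ih (x * q.1) (x * q.2) (y * q.1) (y * q.2) (by
      ext i j; fin_cases i <;> fin_cases j <;> simp [Matrix.mul_apply, Fin.sum_univ_two]
      · linear_combination x * q.1 * hq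
      · linear_combination x * q.2 * hq
      · linear_combination y * q.1 * hq
      · linear_combination y * q.2 * hq)
    convert this using 1
    ext
    · simp only; linear_combination -q.1 * hp
    · simp only; linear_combination -q.2 * hp

end rch

theorem ss_dedekind {D : Type*} [CommRing D] [IsDedekindDomain D]
    (H : ∀ a b : D, IsCoprime a b → Rch (a, b)) (a b : D) (ha : a ≠ 0) : SS (a, b) := by
  set I : Ideal D := Ideal.span {a, b} with hI
  have haI : a ∈ I := Ideal.subset_span (by simp)
  have hbI : b ∈ I := Ideal.subset_span (by simp)
  have hI0 : I ≠ 0 := by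
    intro h
    rw [h] at haI
    exact ha (by simpa using haI)
  obtain ⟨i, hi⟩ := IsDedekindDomain.exists_sup_span_eq (I := I * I) (J := I) Ideal.mul_le_left
    (mul_ne_zero hI0 hI0)
  obtain ⟨J, hJ⟩ : I ∣ Ideal.span {a} := by
    rw [Ideal.dvd_iff_le, Ideal.span_singleton_le_iff_mem]; exact haI
  have hIJ : ∀ s ∈ I, ∀ t ∈ J, a ∣ s * t := by
    intro s hs t ht
    rw [← Ideal.mem_span_singleton, hJ]
    exact Ideal.mul_mem_mul hs ht
  have hiI : i ∈ I := by
    rw [← hi]; exact Ideal.mem_sup_right (Ideal.subset_span (by simp))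
  have h1 : a ∈ I * J := by rw [← hJ]; exact Ideal.subset_span (by simp)
  obtain ⟨x, hx, y, hy, hxy⟩ : ∃ x ∈ J, ∃ y ∈ J, a * x + b * y = a := by
    have h2 := h1
    rw [hI, Ideal.span_insert, Ideal.sup_mul, Submodule.mem_sup] at h2
    obtain ⟨s, hs, t, ht, hst⟩ := h2
    rw [Ideal.mem_span_singleton_mul] at hs ht
    obtain ⟨x, hx, rfl⟩ := hs
    obtain ⟨y, hy, rfl⟩ := ht
    exact ⟨x, hx, y, hy, hst⟩
  obtain ⟨l, hl, j, hj, hlj⟩ : ∃ l ∈ I, ∃ j ∈ J, a * l + i * j = a := by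
    have h2 := h1
    rw [← hi, Ideal.sup_mul, mul_assoc, ← hJ, Submodule.mem_sup] at h2
    obtain ⟨s, hs, t, ht, hst⟩ := h2
    rw [Ideal.mem_span_singleton_mul] at ht
    rw [mul_comm, Ideal.mem_span_singleton_mul] at hs
    obtain ⟨x, hx, rfl⟩ := hs
    obtain ⟨y, hy, rfl⟩ := ht
    exact ⟨x, hx, y, hy, hst⟩
  obtain ⟨t12, h12⟩ := hIJ b hbI x hx
  obtain ⟨t22, h22⟩ := hIJ b hbI y hy
  obtain ⟨m1, hm1⟩ := hIJ i hiI y hy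
  obtain ⟨m2, hm2⟩ := hIJ i hiI x hx
  obtain ⟨l1, hl1⟩ := hIJ l hl x hx
  obtain ⟨l2, hl2⟩ := hIJ l hl y hy
  obtain ⟨z, hz⟩ := hIJ b hbI j hj
  have e1 : x + t22 = 1 := mul_left_cancel₀ ha (by linear_combination hxy - h22)
  have hcop : IsCoprime (a + m1) (b - m2) := by
    refine ⟨l1 + z, l2 - j, ?_⟩
    apply mul_left_cancel₀ ha
    apply mul_left_cancel₀ ha
    linear_combination (-(a * a) - a * m1) * hl1 - a * (b - m2) * hl2 - (a * a + a * m1) * hz + a * l * hxy + a * hlj - (l * x + b * j) * hm1 + (l * y - a * j) * hm2 + i * j * hxy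
  have hS := ss_of_rch (H _ _ hcop)
  have e2 : a * t12 * y = a * t22 * x := by rw [← h12, ← h22]; ring
  have e3 : t12 * y = t22 * x := mul_left_cancel₀ ha (by linear_combination e2)
  have := ss_mul hS x t12 y t22 (by
      ext i j; fin_cases i <;> fin_cases j <;> simp [Matrix.mul_apply, Fin.sum_univ_two]
      · linear_combination e3 + x * e1
      · linear_combination t12 * e1
      · linear_combination y * e1
      · linear_combination e3 + t22 * e1)
  convert this using 2
  · apply mul_left_cancel₀ ha
    linear_combination -a * hxy + x * hm1 - y * hm2
  · apply mul_left_cancel₀ ha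
    apply mul_left_cancel₀ ha
    linear_combination -a * b * hxy + a*a*h12 + a * b*h22 + t12 * a * hm1 - t22 * a * hm2 - i * y * h12 + i * x * h22 - 2 * a * i * e3

theorem ss_all {D : Type*} [CommRing D] [IsDedekindDomain D]
    (H : ∀ a b : D, IsCoprime a b → Rch (a, b)) (a b : D) : SS (a, b) := by
  by_cases ha : a = 0
  · by_cases hb : b = 0
    · subst ha hb
      apply IsIdemProd.of_idem
      ext i j; fin_cases i <;> fin_cases j <;> simp [Matrix.mul_apply, Fin.sum_univ_two]
    ·
      have := ss_mul (ss_dedekind H b b hb) 0 0 0 1 (by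
        ext i j; fin_cases i <;> fin_cases j <;> simp [Matrix.mul_apply, Fin.sum_univ_two])
      subst ha
      simpa using this
  · exact ss_dedekind H a b ha

theorem colrow_of_rch {D : Type*} [CommRing D] [IsDedekindDomain D]
    (H : ∀ a b : D, IsCoprime a b → Rch (a, b)) (a b x y : D) :
    IsIdemProd !![x * a, x * b; y * a, y * b] := by
  have h1 : IsIdemProd !![a, b; 0, 0] := ss_all H a b
  have h2 : IsIdemProd (!![x, y; 0, 0] : Matrix (Fin 2) (Fin 2) D).transpose :=
    IsIdemProd.transpose' (ss_all H x y)
  have := h2.mul' h1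
  convert this using 1
  ext i j; fin_cases i <;> fin_cases j <;> simp [Matrix.mul_apply, Fin.sum_univ_two]

/-- splitting off the part of `x` supported at the primes of `n` -/
theorem split_part (n : ℤ) : ∀ (k : ℕ) (x : ℤ), x ≠ 0 → x.natAbs ≤ k →
    ∃ u c : ℤ, ∃ r : ℕ, x = u * c ∧ u ∣ n ^ r ∧ IsCoprime c n := by
  intro k
  induction k with
  | zero => intro x hx hk; omega
  | succ k ih =>
    intro x hx hk
    by_cases hc : IsCoprime x n
    · exact ⟨1, x, 0, by simp, by simp, hc⟩
    · have hg : Int.gcd x n ≠ 1 := fun h => hc (Int.isCoprime_iff_gcd_eq_one.2 h)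
      have hg0 : Int.gcd x n ≠ 0 := fun h => hx (Int.gcd_eq_zero_iff.1 h).1
      obtain ⟨x', hx'⟩ := Int.gcd_dvd_left (a := x) (b := n)
      have hx'0 : x' ≠ 0 := by rintro rfl; simp at hx'; exact hx hx'
      have hlt : x'.natAbs ≤ k := by
        have h1 : x.natAbs = Int.gcd x n * x'.natAbs := by
          conv_lhs => rw [hx']
          rw [Int.natAbs_mul]; simp
        have h2 : 2 ≤ Int.gcd x n := by omega
        have h3 : 0 < x'.natAbs := by omega
        nlinarith
      obtain ⟨u, c, r, h1, h2, h3⟩ := ih x' hx'0 hlt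
      refine ⟨(Int.gcd x n : ℤ) * u, c, r + 1, ?_, ?_, h3⟩
      · rw [mul_assoc, ← h1]; exact hx'
      · rw [pow_succ, mul_comm]
        exact mul_dvd_mul h2 (Int.gcd_dvd_right (a := x) (b := n))

theorem split_part' (n x : ℤ) (hx : x ≠ 0) :
    ∃ u c : ℤ, ∃ r : ℕ, x = u * c ∧ u ∣ n ^ r ∧ IsCoprime c n :=
  split_part n _ x hx le_rfl

/-- binomial to second order -/
theorem pow_second {R : Type*} [CommRing R] (X Z : R) (i : ℕ) :
    ∃ q : R, (X + Z) ^ (i + 1) = X ^ (i + 1) + (i + 1 : ℕ) * X ^ i * Z + Z ^ 2 * q := by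
  induction i with
  | zero => exact ⟨0, by simp⟩
  | succ i ih =>
    obtain ⟨q, hq⟩ := ih
    refine ⟨(i + 1 : ℕ) * X ^ i + (X + Z) * q, ?_⟩
    rw [pow_succ, hq]
    push_cast
    ring

theorem pow_third (x : ℤ) (i : ℕ) :
    ∃ q : ℤ, 2 * (1 + x) ^ i = 2 + 2 * i * x + i * (i - 1) * x ^ 2 + x ^ 3 * q := by
  induction i with
  | zero => exact ⟨0, by simp⟩
  | succ i ih =>
    obtain ⟨q, hq⟩ := ih
    refine ⟨i * (i - 1) + (1 + x) * q, ?_⟩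
    rw [pow_succ, ← mul_assoc, hq]
    push_cast
    ring

theorem lift_pow {N W : ℤ} (hodd : Odd N) (hpos : 0 < N) (hNW : N ∣ W) (k : ℕ) (c : ℤ) :
    ∃ c', (1 + W * N ^ k * c) ^ N.natAbs = 1 + W * N ^ (k + 1) * c' ∧ N ∣ c' - c := by
  obtain ⟨q, hq⟩ := pow_third (W * N ^ k * c) N.natAbs
  have hN : ((N.natAbs : ℕ) : ℤ) = N := by omega
  rw [hN] at hq
  obtain ⟨m, hm⟩ := hodd
  obtain ⟨w, hw⟩ := hNW
  have hodd' : Odd N := ⟨m, hm⟩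
  set Y := (1 + W * N ^ k * c) ^ N.natAbs with hY
  have h1 : (W * N ^ k * c) ^ 3 * q = 2 * (Y - 1 - N * (W * N ^ k * c) - N * m * (W * N ^ k * c) ^ 2) := by
    have : N - 1 = 2 * m := by omega
    linear_combination -hq - N * (W * N ^ k * c) ^ 2 * this
  have h2 : (W * N ^ k * c) ^ 3 * q = W * N ^ (k + 1) * (N * (w ^ 2 * N ^ (2 * k) * c ^ 3 * q)) := by
    rw [hw]; ring
  by_cases hW0 : W = 0
  · subst hW0
    refine ⟨c, ?_, by simp⟩
    simp [hY]
  have h3 : W * N ^ (k + 1) * N ∣ 2 * (Y - 1 - N * (W * N ^ k * c) - N * m * (W * N ^ k * c) ^ 2) := by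
    rw [← h1, h2]; exact ⟨w ^ 2 * N ^ (2 * k) * c ^ 3 * q, by ring⟩
  have h4 : W * N ^ (k + 1) * N ∣ Y - 1 - N * (W * N ^ k * c) - N * m * (W * N ^ k * c) ^ 2 := by
    obtain ⟨q2, hq2⟩ := pow_second (1 : ℤ) (W * N ^ k * c) (N.natAbs - 1)
    have hsub : N.natAbs - 1 + 1 = N.natAbs := by omega
    rw [hsub] at hq2
    simp only [one_pow, mul_one, hN, ← hY] at hq2
    have h5 : Y - 1 - N * (W * N ^ k * c) - N * m * (W * N ^ k * c) ^ 2
        = W * ((N ^ k * c) * (W * N ^ k * c) * (q2 - N * m)) := by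
      linear_combination hq2
    rw [h5] at h3 ⊢
    rw [mul_assoc] at h3 ⊢
    apply mul_dvd_mul_left
    have h6 : N ^ (k + 1) * N ∣ 2 * ((N ^ k * c) * (W * N ^ k * c) * (q2 - N * m)) := by
      apply Int.dvd_of_mul_dvd_mul_left hW0
      convert h3 using 1; ring
    refine IsCoprime.dvd_of_dvd_mul_left ?_ h6
    have h7 : IsCoprime N 2 := ⟨1, -m, by rw [hm]; ring⟩
    exact (h7.pow_left).mul_left h7
  obtain ⟨s, hs⟩ := h4
  refine ⟨c + m * w * N ^ k * c ^ 2 * N + N * s, ?_, ⟨m * w * N ^ k * c ^ 2 + s, by ring⟩⟩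
  have h8 : N * m * (W * N ^ k * c) ^ 2 = W * N ^ (k + 1) * (m * w * N ^ k * c ^ 2 * N) := by
    rw [hw]; ring
  linear_combination hs + h8

theorem lemmaJ {N W c0 n p : ℤ} {e : ℕ} (hodd : Odd N) (hpos : 0 < N) (hNW : N ∣ W)
    (hn : n ^ e - 1 = W * c0) (hc0 : IsCoprime c0 N) (hp : W * N ∣ p - n) (hcn : IsCoprime n N) :
    ∀ k : ℕ, ∃ j : ℕ, W * N ^ k ∣ p ^ j - n := by
  have key : ∀ k : ℕ, ∃ c, p ^ (e * N.natAbs ^ k) = 1 + W * N ^ k * c ∧ N ∣ c - c0 := by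
    intro k
    induction k with
    | zero =>
      obtain ⟨s, hs⟩ : W * N ∣ p ^ e - n ^ e := hp.trans (sub_dvd_pow_sub_pow p n e)
      exact ⟨c0 + N * s, by simp; linear_combination hs + hn, ⟨s, by ring⟩⟩
    | succ k ih =>
      obtain ⟨c, hc, hcd⟩ := ih
      obtain ⟨c', hc', hcd'⟩ := lift_pow hodd hpos hNW k c
      refine ⟨c', ?_, ?_⟩
      · rw [pow_succ, ← mul_assoc, pow_mul, hc, hc']
      · have := dvd_add hcd' hcd
        simpa using this
  intro k
  induction k with
  | zero => exact ⟨1, by simpa using (Dvd.intro _ rfl).trans hp⟩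
  | succ k ih =>
    obtain ⟨j, s, hj⟩ := ih
    obtain ⟨c, hc, c1, hcd⟩ := key k
    have hcN : IsCoprime (n * c) N := by
      refine hcn.mul_left ?_
      have : c = c0 + N * c1 := by linear_combination hcd
      rw [this]
      exact hc0.add_mul_left_left c1
    obtain ⟨α, β, hab⟩ := hcN
    obtain ⟨i, hi⟩ : ∃ i : ℕ, N ∣ s + n * c * i := by
      refine ⟨(-(s * α) % N).natAbs, ?_⟩
      have h1 : (((-(s * α) % N).natAbs : ℕ) : ℤ) = -(s * α) % N := by
        have := Int.emod_nonneg (-(s * α)) hpos.ne'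
        omega
      rw [h1]
      have h2 := Int.emod_add_mul_ediv (-(s * α)) N
      refine ⟨s * β - n * c * (-(s * α) / N), ?_⟩
      linear_combination n * c * h2 - s * hab
    obtain ⟨t, ht⟩ := hi
    obtain ⟨w, hw⟩ := hNW
    refine ⟨j + e * N.natAbs ^ k * i, ?_⟩
    rw [pow_add p, pow_mul p, hc]
    rcases i with _ | i
    · simp at ht ⊢
      rw [hj, ht]
      exact ⟨t, by ring⟩
    · obtain ⟨q, hq⟩ := pow_second (1 : ℤ) (W * N ^ k * c) i
      rw [hq]
      have hj' : p ^ j = n + W * N ^ k * s := by linear_combination hj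
      rw [hj']
      simp only [one_pow, mul_one]
      push_cast at ht ⊢
      refine ⟨t + w * s * N ^ k * (i + 1) * c + (n + W * N ^ k * s) * (w * N ^ k * c ^ 2 * q), ?_⟩
      have : W * N ^ (k + 1) * t = W * N ^ k * (s + n * c * (i + 1)) := by rw [ht]; ring
      subst hw
      linear_combination -this

section prime
variable {d : ℤ}

/-- two elements congruent modulo an integer -/
theorem zs_norm_mul_dvd {p : ℤ} (hp : Prime p) {a z : ℤ√d} (hn : ¬ p ∣ a.norm)
    (h : (p : ℤ√d) ∣ a * z) : (p : ℤ√d) ∣ z := by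
  have h1 : (p : ℤ√d) ∣ (a.norm : ℤ√d) * z := by
    rw [Zsqrtd.norm_eq_mul_conj]
    obtain ⟨t, ht⟩ := h
    exact ⟨t * star a, by linear_combination star a * ht⟩
  rw [Zsqrtd.intCast_dvd] at h1 ⊢
  rw [Zsqrtd.re_smul, Zsqrtd.im_smul] at h1
  exact ⟨(hp.dvd_or_dvd h1.1).resolve_left hn, (hp.dvd_or_dvd h1.2).resolve_left hn⟩

theorem zs_norm_pow (a : ℤ√d) (k : ℕ) : (a ^ k).norm = a.norm ^ k :=
  map_pow (Zsqrtd.normMonoidHom) a k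

theorem zs_star_pow (a : ℤ√d) (k : ℕ) : star (a ^ k) = star a ^ k := star_pow a k

/-- Frobenius for a split prime -/
theorem frob {p h : ℕ} (hp : p.Prime) (hh : p = 2 * h + 1) (hd : (p : ℤ) ∣ d ^ h - 1) (a : ℤ√d) :
    ((p : ℤ) : ℤ√d) ∣ a ^ p - a := by
  have := Fact.mk hp
  have fermat : ∀ x : ℤ, (p : ℤ) ∣ x ^ p - x := by
    intro x
    rw [← Int.modEq_iff_dvd, ← ZMod.intCast_eq_intCast_iff]
    push_cast
    rw [ZMod.pow_card]
  obtain ⟨x, y⟩ := a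
  rw [Zsqrtd.decompose]
  obtain ⟨r, hr⟩ := exists_add_pow_prime_eq hp (x : ℤ√d) (Zsqrtd.sqrtd (d := d) * y)
  have h1 : (Zsqrtd.sqrtd (d := d)) ^ p = (d : ℤ√d) ^ h * Zsqrtd.sqrtd := by
    rw [hh, pow_succ, pow_mul, sq, Zsqrtd.dmuld]
  obtain ⟨u, hu⟩ := fermat x
  obtain ⟨v, hv⟩ := fermat y
  obtain ⟨w, hw⟩ := hd
  have hu' := congrArg (Int.cast (R := ℤ√d)) hu
  have hv' := congrArg (Int.cast (R := ℤ√d)) hv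
  have hw' := congrArg (Int.cast (R := ℤ√d)) hw
  push_cast at hu' hv' hw'
  rw [hr, mul_pow, h1]
  refine ⟨(u : ℤ√d) + (d : ℤ√d) ^ h * Zsqrtd.sqrtd * (v : ℤ√d) + (w : ℤ√d) * Zsqrtd.sqrtd * (y : ℤ√d)
    + (x : ℤ√d) * (Zsqrtd.sqrtd * (y : ℤ√d)) * r, ?_⟩
  push_cast
  linear_combination hu' + (d : ℤ√d) ^ h * Zsqrtd.sqrtd * hv' + Zsqrtd.sqrtd * y * hw'

theorem half_pow_int {p h : ℕ} (hp : p.Prime) (hh : p = 2 * h + 1) (hd : (p : ℤ) ∣ d ^ h - 1)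
    (a : ℤ√d) (ha : (p : ℤ) ∣ a.norm ^ h - 1) : (p : ℤ) ∣ (a ^ h).im := by
  have hpp : Prime (p : ℤ) := Nat.prime_iff_prime_int.1 hp
  have h0 : 0 < h := by
    rcases Nat.eq_zero_or_pos h with h | h
    · subst h; simp at hh; subst hh; exact absurd hp (by norm_num)
    · exact h
  have hn : ¬ (p : ℤ) ∣ a.norm := by
    intro h1
    have h2 : (p : ℤ) ∣ a.norm ^ h := dvd_pow h1 h0.ne'
    have h3 := dvd_sub h2 ha
    simp at h3
    exact hpp.not_isUnit (isUnit_of_dvd_one h3)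
  have h1 : ((p : ℤ) : ℤ√d) ∣ a * ((a ^ h) ^ 2 - 1) := by
    have := frob hp hh hd a
    convert this using 1
    conv_rhs => rw [hh]
    ring
  obtain ⟨s, hs⟩ := zs_norm_mul_dvd hpp hn h1
  set g := a ^ h with hg
  have h2 : ((p : ℤ) : ℤ√d) ∣ g * star g - 1 := by
    rw [← Zsqrtd.norm_eq_mul_conj, hg, zs_norm_pow]
    obtain ⟨w, hw⟩ := ha
    refine ⟨w, ?_⟩
    have hw' := congrArg (Int.cast (R := ℤ√d)) hw
    push_cast at hw' ⊢
    linear_combination hw'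
  obtain ⟨t, ht⟩ := h2
  have h3 : ((p : ℤ) : ℤ√d) ∣ g - star g :=
    ⟨star g * s - g * t, by linear_combination star g * hs - g * ht⟩
  rw [Zsqrtd.intCast_dvd] at h3
  have h4 := h3.2
  simp at h4
  have h5 : (p : ℤ) ∣ 2 * g.im := by convert h4 using 1; ring
  rcases hpp.dvd_or_dvd h5 with h6 | h6
  · exfalso
    have := Int.le_of_dvd (by norm_num) h6
    have := hp.two_le
    have : p = 2 := by omega
    omega
  · exact h6

/-- im is divisible by `m`  -/
theorem im_dvd_pow {m : ℤ} {a : ℤ√d} (h : m ∣ a.im) (k : ℕ) : m ∣ (a ^ k).im := by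
  induction k with
  | zero => simp
  | succ k ih =>
    rw [pow_succ, Zsqrtd.im_mul]
    exact dvd_add (h.mul_left _) (ih.mul_right _)

/-- expansion of a power of `X + Y√d` -/
theorem im_pow_expand (a : ℤ√d) (i : ℕ) :
    ∃ q r: ℤ, (a ^ (i + 1)).im = (i + 1 : ℕ) * a.re ^ i * a.im + a.im ^ 2 * q ∧
      (a ^ (i + 1)).re = a.re ^ (i + 1) + a.im ^ 2 * r := by
  induction i with
  | zero => exact ⟨0, 0, by simp, by simp⟩
  | succ i ih =>
    obtain ⟨q, r, h1, h2⟩ := ih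
    rw [pow_succ, Zsqrtd.im_mul, Zsqrtd.re_mul, h1, h2]
    refine ⟨a.im * r + q * a.re, r * a.re + d * ((i + 1 : ℕ) * a.re ^ i + a.im * q), ?_, ?_⟩
    · push_cast; ring
    · push_cast; ring

theorem im_pow_p {p : ℕ} {a : ℤ√d} (hp0 : 0 < p) {j : ℕ} (hj : 1 ≤ j) (h : (p : ℤ) ^ j ∣ a.im) :
    (p : ℤ) ^ (j + 1) ∣ (a ^ p).im := by
  obtain ⟨q, r, h1, -⟩ := im_pow_expand a (p - 1)
  have : p - 1 + 1 = p := by omega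
  rw [this] at h1
  rw [h1]
  obtain ⟨z, hz⟩ := h
  obtain ⟨j, rfl⟩ : ∃ j', j = j' + 1 := ⟨j - 1, by omega⟩
  refine dvd_add ⟨a.re ^ (p - 1) * z, by rw [hz]; ring⟩ ⟨(p : ℤ) ^ j * z ^ 2 * q, by rw [hz]; ring⟩

theorem im_pow_pf {p : ℕ} {a : ℤ√d} (hp0 : 0 < p) (h : (p : ℤ) ∣ a.im) (f : ℕ) :
    (p : ℤ) ^ (f + 1) ∣ (a ^ (p ^ f)).im := by
  induction f with
  | zero => simpa using h
  | succ f ih =>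
    rw [pow_succ p, pow_mul]
    exact im_pow_p hp0 (by omega) ih

/-- the powers of a unit deep at p -/
theorem unit_tower {p : ℕ} (hp : p.Prime) {w : ℕ} (hw : 2 ≤ w) {u : ℤ√d} {y : ℤ}
    (hre : ¬ (p : ℤ) ∣ u.re) (hy : ¬ (p : ℤ) ∣ y) (hu : u.im = (p : ℤ) ^ w * y) (i : ℕ) :
    ∃ z : ℤ, (u ^ (p ^ i)).im = (p : ℤ) ^ (w + i) * z ∧ ¬ (p : ℤ) ∣ z ∧
      ¬ (p : ℤ) ∣ (u ^ (p ^ i)).re := by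
  have hpp : Prime (p : ℤ) := Nat.prime_iff_prime_int.1 hp
  induction i with
  | zero => exact ⟨y, by simpa using hu, hy, by simpa using hre⟩
  | succ i ih =>
    obtain ⟨z, h1, h2, h3⟩ := ih
    rw [pow_succ p, pow_mul]
    set v := u ^ (p ^ i) with hv
    obtain ⟨q, r, h4, h5⟩ := im_pow_expand v (p - 1)
    have : p - 1 + 1 = p := by have := hp.pos; omega
    rw [this] at h4 h5
    obtain ⟨w, rfl⟩ : ∃ w', w = w' + 2 := ⟨w - 2, by omega⟩
    refine ⟨v.re ^ (p - 1) * z + p * ((p : ℤ) ^ (w + i) * z ^ 2 * q), ?_, ?_, ?_⟩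
    · rw [h4, h1]; ring
    · intro h
      have h6 : (p : ℤ) ∣ v.re ^ (p - 1) * z := (dvd_add_left (Dvd.intro _ rfl)).1 h
      rcases hpp.dvd_or_dvd h6 with h7 | h7
      · exact h3 (hpp.dvd_of_dvd_pow h7)
      · exact h2 h7
    · intro h
      rw [h5] at h
      have h6 : (p : ℤ) ∣ v.im ^ 2 * r := by
        rw [h1]; exact ⟨p ^ (w + i + 1) * z * (p ^ (w + 2 + i) * z) * r, by ring⟩
      exact h3 (hpp.dvd_of_dvd_pow ((dvd_add_left h6).1 h))

theorem kill_im {p : ℕ} (hp : p.Prime) {w : ℕ} (hw : 2 ≤ w) {u : ℤ√d} {y : ℤ}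
    (hre : ¬ (p : ℤ) ∣ u.re) (hy : ¬ (p : ℤ) ∣ y) (hu : u.im = (p : ℤ) ^ w * y)
    {G : ℤ√d} (hG : (p : ℤ) ^ w ∣ G.im) (hGr : ¬ (p : ℤ) ∣ G.re) (i : ℕ) :
    ∃ m : ℕ, (p : ℤ) ^ (w + i) ∣ (G * u ^ m).im ∧ ¬ (p : ℤ) ∣ (G * u ^ m).re := by
  have hpp : Prime (p : ℤ) := Nat.prime_iff_prime_int.1 hp
  induction i with
  | zero => exact ⟨0, by simpa using hG, by simpa using hGr⟩
  | succ i ih =>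
    obtain ⟨m, ⟨s, hs⟩, h2⟩ := ih
    obtain ⟨z, h3, h4, h5⟩ := unit_tower hp hw hre hy hu i
    set v := u ^ (p ^ i) with hv
    set H := G * u ^ m with hH
    have hc : IsCoprime (H.re * z) (p : ℤ) := by
      rw [isCoprime_comm, Prime.coprime_iff_not_dvd hpp]
      intro h
      rcases hpp.dvd_or_dvd h with h | h
      · exact h2 h
      · exact h4 h
    obtain ⟨α, β, hab⟩ := hc
    obtain ⟨t, ht⟩ : ∃ t : ℕ, (p : ℤ) ∣ s * v.re + (t + 1 : ℕ) * (H.re * z) := by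
      have hp0 : (p : ℤ) ≠ 0 := hpp.ne_zero
      refine ⟨((-(s * v.re * α) - 1) % p).natAbs, ?_⟩
      have h1 : ((((-(s * v.re * α) - 1) % p).natAbs : ℕ) : ℤ) = (-(s * v.re * α) - 1) % p := by
        have := Int.emod_nonneg (-(s * v.re * α) - 1) hp0
        omega
      push_cast [h1]
      have h6 := Int.emod_add_mul_ediv (-(s * v.re * α) - 1) p
      refine ⟨s * v.re * β - H.re * z * ((-(s * v.re * α) - 1) / p), ?_⟩
      linear_combination H.re * z * h6 - s * v.re * hab
    obtain ⟨q, r, h6, h7⟩ := im_pow_expand v t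
    obtain ⟨x, hx⟩ := ht
    obtain ⟨w, rfl⟩ : ∃ w', w = w' + 2 := ⟨w - 2, by omega⟩
    refine ⟨m + p ^ i * (t + 1), ?_, ?_⟩
    · rw [pow_add u, pow_mul u, ← mul_assoc, ← hv, ← hH, Zsqrtd.im_mul, h6, h7, hs, h3]
      refine ⟨v.re ^ t * x + H.re * ((p : ℤ) ^ (w + i + 1) * z ^ 2 * q) + s * (p ^ (w + 2 + i) * z ^2 * p ^ (w + 1 + i)* r), ?_⟩
      have : (p : ℤ) ^ (w + 2 + (i + 1)) * (v.re ^ t * x) = p ^ (w + 2 + i) * v.re ^ t * (s * v.re + (t + 1 : ℕ) * (H.re * z)) := by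
        rw [hx]; ring
      push_cast at this ⊢
      linear_combination -this
    · rw [pow_add u, pow_mul u, ← mul_assoc, ← hv, ← hH, Zsqrtd.re_mul, h7, hs]
      intro h
      have e : (p : ℤ) ∣ H.re * (v.im ^ 2 * r) + d * (p ^ (w + 2 + i) * s) * (v ^ (t + 1)).im := by
        rw [h3]
        exact ⟨H.re * (p ^ (w + 1 + i) * z * (p ^ (w + 2 + i) * z) * r) + d * (p ^ (w + 1 + i) * s) * (v ^ (t + 1)).im, by ring⟩
      have e2 : (p : ℤ) ∣ H.re * v.re ^ (t + 1) := by
        obtain ⟨t1, e1⟩ := h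
        obtain ⟨t2, e2⟩ := e
        exact ⟨t1 - t2, by linear_combination e1 - e2⟩
      rcases hpp.dvd_or_dvd e2 with h8 | h8
      · exact h2 h8
      · exact h5 (hpp.dvd_of_dvd_pow h8)

/-- a unit which is deep at `p` -/
theorem deep_unit {p : ℕ} (hp : p.Prime) (hd0 : 0 < d) (hsq : ¬ IsSquare d) :
    ∃ (u : (ℤ√d)ˣ) (w : ℕ) (y : ℤ), 2 ≤ w ∧ ¬ (p : ℤ) ∣ (u : ℤ√d).re ∧ ¬ (p : ℤ) ∣ y ∧
      (u : ℤ√d).im = (p : ℤ) ^ w * y := by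
  have hpp : Prime (p : ℤ) := Nat.prime_iff_prime_int.1 hp
  have hp0 : (p : ℤ) ≠ 0 := hpp.ne_zero
  have h1 : ¬ IsSquare (d * ((p : ℤ) ^ 2) ^ 2) := by
    rintro ⟨r, hr⟩
    have h2 : ((p : ℤ) ^ 2) ^ 2 ∣ r ^ 2 := ⟨d, by rw [sq r, ← hr]; ring⟩
    rw [Int.pow_dvd_pow_iff (by norm_num)] at h2
    obtain ⟨s, rfl⟩ := h2
    apply hsq
    refine ⟨s, ?_⟩
    have h3 : ((p : ℤ) ^ 2) ^ 2 ≠ 0 := by positivity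
    apply mul_left_cancel₀ h3
    linear_combination hr
  obtain ⟨x, y, hxy, hy⟩ := Pell.exists_of_not_isSquare (d := d * ((p : ℤ) ^ 2) ^ 2) (by positivity) h1
  obtain ⟨n, c, hc, hyc⟩ : ∃ (n : ℕ) (c : ℤ), ¬ (p : ℤ) ∣ c ∧ y = (p : ℤ) ^ n * c := by
    have hf : FiniteMultiplicity (p : ℤ) y :=
      FiniteMultiplicity.of_prime_left hpp hy
    obtain ⟨c, h2, h3⟩ := hf.exists_eq_pow_mul_and_not_dvd
    exact ⟨_, c, h3, h2⟩
  have hu : IsUnit (⟨x, (p : ℤ) ^ (n + 2) * c⟩ : ℤ√d) := by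
    rw [Zsqrtd.isUnit_iff_norm_isUnit]
    have : (⟨x, (p : ℤ) ^ (n + 2) * c⟩ : ℤ√d).norm = 1 := by
      rw [Zsqrtd.norm_def]
      rw [hyc] at hxy
      simp only
      linear_combination hxy
    rw [this]; exact isUnit_one
  obtain ⟨u, hu⟩ := hu
  refine ⟨u, n + 2, c, by omega, ?_, hc, by rw [hu]⟩
  rw [hu]
  simp only
  intro h
  have h3 : (p : ℤ) ∣ 1 := by
    rw [← hxy]
    exact dvd_sub (dvd_pow h (by norm_num)) ⟨d * (p : ℤ) ^ 3 * y ^ 2, by ring⟩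
  exact hpp.not_isUnit (isUnit_of_dvd_one h3)

/-- the terminal step -/
theorem rch_prime_pow {p h : ℕ} (hp : p.Prime) (hh : p = 2 * h + 1) (hd0 : 0 < d)
    (hsq : ¬ IsSquare d) (hd : (p : ℤ) ∣ d ^ h - 1)
    (a : ℤ√d) (ha : (p : ℤ) ∣ a.norm ^ h - 1) :
    ∃ f : ℕ, ∀ k j : ℕ, h * p ^ f ∣ k → Rch (a ^ k, ((p ^ j : ℤ) : ℤ√d)) := by
  have hpp : Prime (p : ℤ) := Nat.prime_iff_prime_int.1 hp
  have h0 : h ≠ 0 := by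
    rintro rfl; simp at hh; subst hh; exact absurd hp (by norm_num)
  have hn : ¬ (p : ℤ) ∣ a.norm := by
    intro h1
    have h2 : (p : ℤ) ∣ a.norm ^ h := dvd_pow h1 h0
    have h3 := dvd_sub h2 ha
    simp at h3
    exact hpp.not_isUnit (isUnit_of_dvd_one h3)
  obtain ⟨u, w, y, hw, hre, hy, hu⟩ := deep_unit (d := d) hp hd0 hsq
  refine ⟨w, fun k j hk => ?_⟩
  obtain ⟨k', rfl⟩ := hk
  set G := a ^ (h * p ^ w * k') with hG
  have hGim : (p : ℤ) ^ w ∣ G.im := by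
    rw [hG, pow_mul, pow_mul]
    apply im_dvd_pow
    exact (pow_dvd_pow _ (by omega)).trans (im_pow_pf hp.pos (half_pow_int hp hh hd a ha) w)
  have hGre : ¬ (p : ℤ) ∣ G.re := by
    intro h1
    have h2 : (p : ℤ) ∣ G.norm := by
      rw [Zsqrtd.norm_def]
      refine dvd_sub (h1.mul_right _) (((dvd_pow_self (p : ℤ) (by omega)).trans hGim).mul_left _)
    rw [hG, zs_norm_pow] at h2
    exact hn (hpp.dvd_of_dvd_pow h2)
  obtain ⟨m, h1, h2⟩ := kill_im hp hw hre hy hu hGim hGre j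
  rw [← rch_unitL (u ^ m)]
  have h3 : Rch ((((G * (u : ℤ√d) ^ m).re : ℤ) : ℤ√d), ((p ^ j : ℤ) : ℤ√d)) := by
    apply rch_int
    apply IsCoprime.pow_right
    rw [isCoprime_comm, Prime.coprime_iff_not_dvd hpp]
    exact h2
  refine rch_congL ?_ h3
  rw [Zsqrtd.intCast_dvd]
  constructor
  · simp [mul_comm]
  · have h4 : (p : ℤ) ^ j ∣ (G * (u : ℤ√d) ^ m).im := (pow_dvd_pow _ (by omega)).trans h1
    rw [mul_comm] at h4
    rw [Zsqrtd.im_sub, Zsqrtd.im_intCast, zero_sub, dvd_neg]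
    push_cast
    exact h4

end prime

section core
variable {d : ℤ}

theorem zs_norm_cong {m : ℤ} {x y : ℤ√d} (h : (m : ℤ√d) ∣ x - y) : m ∣ x.norm - y.norm := by
  rw [Zsqrtd.intCast_dvd] at h
  obtain ⟨⟨s, hs⟩, ⟨t, ht⟩⟩ := h
  simp at hs ht
  rw [Zsqrtd.norm_def, Zsqrtd.norm_def]
  exact ⟨s * (x.re + y.re) - d * t * (x.im + y.im), by
    linear_combination (x.re + y.re) * hs - d * (x.im + y.im) * ht⟩

theorem zs_norm_coprime {m : ℤ} {a : ℤ√d} (h : IsCoprime a (m : ℤ√d)) : IsCoprime a.norm m := by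
  obtain ⟨s, t, hst⟩ := h
  have h1 : (m : ℤ√d) ∣ s * a - 1 := ⟨-t, by linear_combination hst⟩
  obtain ⟨q, hq⟩ := zs_norm_cong h1
  rw [Zsqrtd.norm_mul, Zsqrtd.norm_one] at hq
  exact ⟨s.norm, -q, by linear_combination hq⟩

theorem exists_period {n : ℤ} (hn : n ≠ 0) {a : ℤ√d} (h : IsCoprime a (n : ℤ√d)) :
    ∃ L : ℕ, 0 < L ∧ (n : ℤ√d) ∣ a ^ L - 1 := by
  have : NeZero n.natAbs := ⟨by omega⟩
  obtain ⟨i, j, hij, he⟩ := Finite.exists_ne_map_eq_of_infinite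
    (fun i : ℕ => (((a ^ i).re : ZMod n.natAbs), ((a ^ i).im : ZMod n.natAbs)))
  wlog hlt : i < j generalizing i j
  · exact this j i hij.symm he.symm (by omega)
  obtain ⟨k, rfl⟩ : ∃ k, j = i + k := ⟨j - i, by omega⟩
  simp only [Prod.mk.injEq] at he
  obtain ⟨h1, h2⟩ := he
  rw [ZMod.intCast_eq_intCast_iff, Int.modEq_iff_dvd, Int.natAbs_dvd] at h1 h2
  refine ⟨k, by omega, ?_⟩
  have h3 : (n : ℤ√d) ∣ a ^ i * (a ^ k - 1) := by
    have : a ^ i * (a ^ k - 1) = a ^ (i + k) - a ^ i := by ring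
    rw [this, Zsqrtd.intCast_dvd]
    simpa using ⟨h1, h2⟩
  exact (IsCoprime.dvd_of_dvd_mul_left (h.symm.pow_right) h3)

theorem normalize_a {n M : ℤ} (hd0 : 0 < d) (hn : Odd n) (hM : M ≠ 0) (h8 : 8 ∣ M) {a : ℤ√d}
    (h : IsCoprime a (n : ℤ√d)) :
    ∃ a' : ℤ√d, (n : ℤ√d) ∣ a' - a ∧ a'.norm < 0 ∧ 8 ∣ a'.norm - 1 ∧
      IsCoprime a'.norm M ∧ IsCoprime a'.norm n := by
  obtain ⟨M1, M2, r, h1, h2, h3⟩ := split_part' n M hM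
  have hn0 : n ≠ 0 := by rintro rfl; simp at hn
  have hM2 : M2 ≠ 0 := by rintro rfl; simp at h1; exact hM h1
  have h8' : 8 ∣ M2 := by
    have hc : IsCoprime (8 : ℤ) (n ^ r) := by
      have : IsCoprime (2 : ℤ) n := by
        obtain ⟨m, hm⟩ := hn
        exact ⟨-m, 1, by rw [hm]; ring⟩
      have := (this.pow_left (m := 3)).pow_right (n := r)
      norm_num at this
      exact this
    rw [h1] at h8
    exact (hc.of_isCoprime_of_dvd_right h2).dvd_of_dvd_mul_left h8
  obtain ⟨m, s, hms⟩ := h3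
  set a2 : ℤ√d := a + n * s * (1 - a) with ha2
  set t : ℤ := |a2.re| + |a2.im| + 1 with ht
  set K : ℤ := n * M2 with hK
  set a' : ℤ√d := a2 + (⟨0, K * (K * t)⟩ : ℤ√d) with ha'
  have e1 : (⟨0, K * (K * t)⟩ : ℤ√d) = n * M2 * (⟨0, K * t⟩ : ℤ√d) := by
    ext <;> simp [hK]
  have hms' := congrArg (Int.cast (R := ℤ√d)) hms
  push_cast at hms'
  have d1 : (n : ℤ√d) ∣ a' - a := by
    refine ⟨s * (1 - a) + M2 * (⟨0, K * t⟩ : ℤ√d), ?_⟩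
    rw [ha', ha2, e1]; ring
  have d2 : (M2 : ℤ√d) ∣ a' - 1 := by
    refine ⟨(a - 1) * m + n * (⟨0, K * t⟩ : ℤ√d), ?_⟩
    rw [ha', ha2, e1]
    linear_combination -(a - 1) * hms'
  have d3 : M2 ∣ a'.norm - 1 := by simpa using zs_norm_cong d2
  have c2 : IsCoprime a'.norm n := by
    apply zs_norm_coprime
    obtain ⟨q, hq⟩ := d1
    have : a' = a + n * q := by linear_combination hq
    rw [this]
    exact h.add_mul_left_left q
  refine ⟨a', d1, ?_, h8'.trans d3, ?_, c2⟩
  · have hr : a'.re = a2.re := by simp [ha']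
    have hi : a'.im = a2.im + K * (K * t) := by simp [ha']
    have hK0 : K ≠ 0 := mul_ne_zero hn0 hM2
    have hK1 : 1 ≤ K * K := by nlinarith [mul_self_pos.2 hK0]
    have ht1 : 1 ≤ t := by have := abs_nonneg a2.re; have := abs_nonneg a2.im; omega
    have hi2 : |a2.re| + 1 ≤ a'.im := by
      rw [hi]
      have : t ≤ K * (K * t) := by nlinarith
      have := neg_abs_le a2.im
      omega
    rw [Zsqrtd.norm_def, hr]
    have h5 : a2.re * a2.re = |a2.re| * |a2.re| := (abs_mul_abs_self _).symm
    have h6 : a2.re * a2.re < a'.im * a'.im := by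
      rw [h5]; nlinarith [abs_nonneg a2.re]
    nlinarith
  · rw [h1]
    refine IsCoprime.mul_right (c2.pow_right.of_isCoprime_of_dvd_right h2) ?_
    obtain ⟨q, hq⟩ := d3
    exact ⟨1, -q, by linear_combination hq⟩

theorem euler_crit {p h : ℕ} (hp : p.Prime) (hh : p = 2 * h + 1) {x : ℤ}
    (hx : jacobiSym x p = 1) : (p : ℤ) ∣ x ^ h - 1 := by
  have := Fact.mk hp
  rw [← jacobiSym.legendreSym.to_jacobiSym] at hx
  have h1 := legendreSym.eq_pow p x
  rw [hx] at h1
  have h2 : p / 2 = h := by omega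
  rw [h2] at h1
  rw [← Int.modEq_iff_dvd, ← ZMod.intCast_eq_intCast_iff]
  push_cast
  push_cast at h1
  exact h1

theorem jac_d {p d : ℕ} (hd0 : 0 < d) (hp : 8 * d ∣ p + 1) : jacobiSym d p = 1 := by
  obtain ⟨m, hm⟩ := hp
  have hm0 : 0 < m := by
    rcases Nat.eq_zero_or_pos m with rfl | h
    · simp at hm
    · exact h
  have hodd : Odd p := by
    refine ⟨4 * d * m - 1, ?_⟩
    have : 0 < d * m := by positivity
    have : 8 * d * m = 2 * (4 * d * m) := by ring
    have : 4 * d * m = 4 * (d * m) := by ring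
    omega
  rw [jacobiSym.mod_right' d hodd]
  have hmod : p % (4 * d) = 4 * d - 1 := by
    have h1 : p = (4 * d - 1) + 4 * d * (2 * m - 1) := by
      obtain ⟨m, rfl⟩ : ∃ m', m = m' + 1 := ⟨m - 1, by omega⟩
      have : 2 * (m + 1) - 1 = 2 * m + 1 := by omega
      rw [this]
      have : 8 * d * (m + 1) = 4 * d + 4 * d * (2 * m + 1) := by ring
      omega
    rw [h1, Nat.add_mul_mod_self_left, Nat.mod_eq_of_lt (by omega)]
  rw [hmod]
  have hodd2 : Odd (4 * d - 1) := ⟨2 * d - 1, by omega⟩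
  have h4 : jacobiSym 4 (4 * d - 1) = 1 := jacobiSym.at_four hodd2
  have h5 : jacobiSym (4 * d : ℤ) (4 * d - 1) = jacobiSym 1 (4 * d - 1) := by
    apply jacobiSym.mod_left'
    have : (4 * d : ℤ) = 1 + ((4 * d - 1 : ℕ) : ℤ) := by
      push_cast [show 1 ≤ 4 * d by omega]; ring
    rw [this]; simp
  rw [jacobiSym.mul_left, h4, jacobiSym.one_left, one_mul] at h5
  exact h5

theorem jac_norm {p N : ℕ} {n0 : ℤ} (hp : p % 4 = 3) (hN : N % 4 = 3) (hn : jacobiSym n0 N = 1)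
    (h : (N : ℤ) ∣ p - n0) : jacobiSym (-(N : ℤ)) p = 1 := by
  have hpo : Odd p := Nat.odd_iff.2 (by omega)
  rw [jacobiSym.neg _ hpo, ZMod.χ₄_nat_three_mod_four hp,
    jacobiSym.quadratic_reciprocity_three_mod_four hN hp]
  have : jacobiSym (p : ℤ) N = jacobiSym n0 N :=
    jacobiSym.mod_left' (Int.emod_eq_emod_iff_emod_sub_eq_zero.2 (Int.emod_eq_zero_of_dvd h))
  rw [this, hn]; norm_num

theorem exists_sign {N : ℕ} (hN : N % 4 = 3) {n : ℤ} (hc : IsCoprime n (N : ℤ)) :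
    ∃ s : ℤˣ, jacobiSym (s * n) N = 1 := by
  have h1 : jacobiSym n N = 1 ∨ jacobiSym n N = -1 :=
    jacobiSym.eq_one_or_neg_one (Int.isCoprime_iff_gcd_eq_one.1 hc)
  rcases h1 with h1 | h1
  · exact ⟨1, by simpa using h1⟩
  · refine ⟨-1, ?_⟩
    have hpo : Odd N := Nat.odd_iff.2 (by omega)
    rw [Units.val_neg, Units.val_one, neg_one_mul, jacobiSym.neg _ hpo,
      ZMod.χ₄_nat_three_mod_four hN, h1]; norm_num

end core

section core2
variable {d : ℤ}

theorem exists_prime_crt {M Q n0 : ℤ} (hM : M ≠ 0) (hQ : Q ≠ 0) (hMQ : IsCoprime M Q)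
    (hn : IsCoprime n0 Q) : ∃ p : ℕ, p.Prime ∧ M ∣ p + 1 ∧ Q ∣ p - n0 := by
  obtain ⟨α, β, hab⟩ := hMQ
  set r : ℤ := n0 * α * M - β * Q with hr
  have h1 : IsCoprime r M := ⟨-1, α + n0 * α, by rw [hr]; linear_combination hab⟩
  have h2 : IsCoprime r Q := by
    have : r = n0 + Q * (-n0 * β - β) := by rw [hr]; linear_combination n0 * hab
    rw [this]
    exact hn.add_mul_left_left _
  have h3 : IsCoprime r ((M * Q).natAbs : ℤ) := by
    have := h1.mul_right h2
    rcases Int.natAbs_eq (M * Q) with h | h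
    · rwa [← h]
    · rw [h] at this; exact (IsCoprime.neg_right_iff _ _).1 this
  obtain ⟨p, -, hp, hpr⟩ := Nat.forall_exists_prime_gt_and_zmodEq 0
    (q := (M * Q).natAbs) (by simpa using ⟨hM, hQ⟩) h3
  have h4 : M * Q ∣ p - r := by
    have := (Int.modEq_iff_dvd.1 hpr.symm)
    exact Int.natAbs_dvd.1 this
  obtain ⟨t, ht⟩ := h4
  refine ⟨p, hp, ⟨Q * t + n0 * α + α, ?_⟩, ⟨M * t - n0 * β - β, ?_⟩⟩
  · rw [hr] at ht; linear_combination ht - hab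
  · rw [hr] at ht; linear_combination ht + n0 * hab

theorem core_lemma (hd0 : 0 < d) (hsq : ¬ IsSquare d) {n : ℤ} (hn : Odd n) (hn1 : 1 < n.natAbs)
    {a : ℤ√d} (h : IsCoprime a (n : ℤ√d)) : Rch (a, (n : ℤ√d)) := by
  obtain ⟨L, hL0, hL⟩ := exists_period (by omega) h
  set M : ℤ := 8 * d * L with hMdef
  have hM0 : M ≠ 0 := by positivity
  obtain ⟨a', h1, h2, h3, h4, h5⟩ := normalize_a (M := M) hd0 hn hM0 ⟨d * L, by rw [hMdef]; ring⟩ h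
  refine rch_congL h1 ?_
  have hL' : (n : ℤ√d) ∣ a' ^ L - 1 := by
    have := dvd_add (h1.trans (sub_dvd_pow_sub_pow a' a L)) hL
    simpa using this
  clear_value M
  obtain ⟨N, hN⟩ : ∃ N : ℕ, a'.norm = -(N : ℤ) := ⟨(-a'.norm).toNat, by omega⟩
  rw [hN] at h2 h3
  have hN4 : N % 4 = 3 := by omega
  have hNM : IsCoprime (N : ℤ) M := by rw [hN] at h4; exact (IsCoprime.neg_left_iff _ _).1 h4
  have hNn : IsCoprime (N : ℤ) n := by rw [hN] at h5; exact (IsCoprime.neg_left_iff _ _).1 h5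
  obtain ⟨s, hs⟩ := exists_sign hN4 hNn.symm
  set n0 : ℤ := s * n with hn0
  have hn0abs : n0.natAbs = n.natAbs := by rw [hn0, Int.natAbs_mul]; simp
  have hNn0 : IsCoprime n0 (N : ℤ) := by
    rw [hn0]; exact (isCoprime_mul_unit_left_left s.isUnit _ _).2 hNn.symm
  have hn0dvd : (n0 : ℤ√d) ∣ (n : ℤ√d) := by
    refine ⟨((s : ℤ) : ℤ√d), ?_⟩
    rw [hn0]; push_cast
    have : ((s : ℤ) : ℤ√d) * ((s : ℤ) : ℤ√d) = 1 := by
      rw [← Int.cast_mul]; simp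
    linear_combination -(n : ℤ√d) * this
  have hredu : Rch (a', (n0 : ℤ√d)) → Rch (a', (n : ℤ√d)) := by
    intro hh
    rw [hn0] at hh
    rcases Int.units_eq_one_or s with rfl | rfl
    · simpa using hh
    · have := (rch_unitR (-1 : (ℤ√d)ˣ) (a := a') (b := (n : ℤ√d)))
      apply this.1
      simpa using hh
  apply hredu
  have hN0 : 0 < N := by omega
  obtain ⟨e, he0, heN⟩ : ∃ e : ℕ, 0 < e ∧ (N : ℤ) ∣ n0 ^ e - 1 := by
    refine ⟨2 * N.totient, by have := Nat.totient_pos.2 hN0; omega, ?_⟩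
    have hcop : Nat.Coprime n0.natAbs N := by
      have := Int.isCoprime_iff_gcd_eq_one.1 hNn0
      simpa [Int.gcd] using this
    have := ((Nat.ModEq.pow_totient hcop).pow 2).symm
    rw [← Int.natCast_modEq_iff, Int.modEq_iff_dvd] at this
    push_cast at this
    rw [← pow_mul, mul_comm, pow_mul, sq_abs, ← pow_mul] at this
    exact this
  have hne : n0 ^ e - 1 ≠ 0 := by
    intro h0
    have h6 : n0 ^ e = 1 := by omega
    have h7 : n0.natAbs ^ e = 1 := by rw [← Int.natAbs_pow, h6]; rfl
    have h8 := Nat.one_lt_pow he0.ne' (by omega : 1 < n0.natAbs)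
    omega
  obtain ⟨W, c0, r, hW1, hW2, hW3⟩ := split_part' (N : ℤ) (n0 ^ e - 1) hne
  have hW0 : W ≠ 0 := by rintro rfl; simp at hW1; exact hne (by omega)
  have hNW : (N : ℤ) ∣ W := by
    rw [hW1] at heN
    exact hW3.symm.dvd_of_dvd_mul_right heN
  have hMW : IsCoprime M (W * N) := by
    refine IsCoprime.mul_right ?_ hNM.symm
    exact (hNM.symm.pow_right (n := r)).of_isCoprime_of_dvd_right hW2
  have hnW : IsCoprime n0 (W * N) := by
    refine IsCoprime.mul_right ?_ hNn0
    exact (hNn0.pow_right (n := r)).of_isCoprime_of_dvd_right hW2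
  obtain ⟨p, hp, hpM, hpW⟩ := exists_prime_crt hM0 (mul_ne_zero hW0 (by omega)) hMW hnW
  obtain ⟨D, rfl⟩ : ∃ D : ℕ, d = D := ⟨d.toNat, by omega⟩
  have hD0 : 0 < D := by exact_mod_cast hd0
  have hpM' : 8 * D * L ∣ p + 1 := by
    rw [hMdef] at hpM; exact_mod_cast hpM
  obtain ⟨m, hm⟩ := hpM'
  have hp8 : 8 * (D * L * m) = p + 1 := by rw [hm]; ring
  obtain ⟨h', hh⟩ : ∃ h' : ℕ, p = 2 * h' + 1 := ⟨p / 2, by omega⟩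
  have hh' : h' + 1 = L * (4 * D * m) := by
    have : L * (4 * D * m) = 4 * (D * L * m) := by ring
    omega
  have hcopL : Nat.Coprime (h') L := by
    have h6 : Nat.Coprime h' (h' + 1) := by simp
    rw [hh'] at h6
    exact h6.coprime_mul_right_right
  have hcopP : Nat.Coprime p L := by
    have h6 : Nat.Coprime p (p + 1) := by simp
    rw [hm] at h6
    exact h6.coprime_mul_right_right.coprime_mul_left_right
  have hd1 : (p : ℤ) ∣ (D : ℤ) ^ h' - 1 :=
    euler_crit hp hh (jac_d hD0 ⟨L * m, by rw [hm]; ring⟩)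
  have ha1 : (p : ℤ) ∣ a'.norm ^ h' - 1 := by
    rw [hN]
    exact euler_crit hp hh (jac_norm (by omega) hN4 hs ((Dvd.intro_left _ rfl).trans hpW))
  obtain ⟨f, hf⟩ := rch_prime_pow hp hh hd0 hsq hd1 a' ha1
  set k : ℕ := (h' * p ^ f) ^ L.totient with hk
  have hkd : h' * p ^ f ∣ k := dvd_pow_self _ (Nat.totient_pos.2 hL0).ne'
  have hkL : k ≡ 1 [MOD L] := Nat.ModEq.pow_totient (hcopL.mul_left (hcopP.pow_left f))
  have hk1 : 1 ≤ k := by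
    have : 0 < h' := by
      rcases Nat.eq_zero_or_pos h' with h0 | h0
      · subst h0; simp at hh; subst hh; exact absurd hp (by norm_num)
      · exact h0
    have := hp.pos
    rw [hk]; exact Nat.one_le_iff_ne_zero.2 (by positivity)
  clear_value k
  obtain ⟨q, hq⟩ := (Nat.modEq_iff_dvd' hk1).1 hkL.symm
  have hodd : Odd (N : ℤ) := by
    rw [Int.odd_coe_nat]; exact Nat.odd_iff.2 (by omega)
  obtain ⟨j, hj⟩ := lemmaJ hodd (by exact_mod_cast hN0) hNW hW1 hW3 hpW hNn0 k
  have hfin := hf k j hkd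
  have hA : Rch (a' ^ k, (n0 : ℤ√(D : ℤ))) := by
    refine rch_congR ?_ hfin
    have h6 : a' ∣ ((N : ℤ) : ℤ√(D : ℤ)) := by
      refine ⟨-star a', ?_⟩
      have := Zsqrtd.norm_eq_mul_conj a'
      rw [hN] at this
      push_cast at this ⊢
      linear_combination -this
    refine (pow_dvd_pow_of_dvd h6 k).trans ?_
    obtain ⟨t, ht⟩ := hj
    refine ⟨(W * t : ℤ), ?_⟩
    have := congrArg (Int.cast (R := ℤ√(D : ℤ))) ht
    push_cast at this ⊢
    linear_combination this
  refine rch_congL ?_ hA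
  refine hn0dvd.trans ?_
  have hk2 : k = 1 + L * q := by omega
  rw [hk2, pow_add, pow_one, pow_mul]
  have : (n : ℤ√(D : ℤ)) ∣ (a' ^ L) ^ q - 1 := by
    have h7 := sub_dvd_pow_sub_pow (a' ^ L) 1 q
    rw [one_pow] at h7
    exact hL'.trans h7
  have h8 := this.mul_left a'
  convert h8 using 1
  ring

end core2

section zthm
variable {d : ℤ}

theorem int_coprime_of_primes {x y : ℤ} (hy : y ≠ 0) (h : ∀ p : ℤ, Prime p → p ∣ x → p ∣ y → False) :
    IsCoprime x y := by
  refine isCoprime_of_prime_dvd (fun h0 => hy h0.2) ?_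
  intro p hp h1 h2
  exact h p hp h1 h2

theorem rch_zsqrtd (hd0 : 0 < d) (hsq : ¬ IsSquare d) {a b : ℤ√d} (h : IsCoprime a b) :
    Rch (a, b) := by
  by_cases hb : b = 0
  · subst hb
    have hu : IsUnit a := isCoprime_zero_right.1 h
    obtain ⟨u, rfl⟩ := hu
    have := (rch_unitL u (a := (1 : ℤ√d)) (b := 0)).2 rch_one
    simpa using this
  have hsq' : ∀ n : ℤ, d ≠ n * n := fun n hn => hsq ⟨n, hn⟩
  have hB : b.norm ≠ 0 := fun h0 => hb ((Zsqrtd.norm_eq_zero hsq' b).1 h0)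
  obtain ⟨B, hBdef⟩ : ∃ B, B = b.norm := ⟨_, rfl⟩
  rw [← hBdef] at hB
  have hbB : b ∣ (B : ℤ√d) := ⟨star b, by rw [hBdef, Zsqrtd.norm_eq_mul_conj]⟩
  obtain ⟨a1, ha1, ha1'⟩ : ∃ a1 : ℤ√d, b ∣ a1 - a ∧ a1.im ≠ 0 := by
    by_cases h0 : a.im = 0
    · refine ⟨a + B * ⟨0, 1⟩, ?_, ?_⟩
      · have : a + B * ⟨0, 1⟩ - a = B * (⟨0, 1⟩ : ℤ√d) := by ring
        rw [this]; exact hbB.mul_right _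
      · simpa [h0] using hB
    · exact ⟨a, by simp, h0⟩
  refine rch_congL ha1 ?_
  have h1 : IsCoprime a1 b := by
    obtain ⟨q, hq⟩ := ha1
    have : a1 = a + b * q := by linear_combination hq
    rw [this]; exact h.add_mul_left_left q
  obtain ⟨u, c, r, hy, hu, hc⟩ := split_part' a1.re a1.im ha1'
  have hc0 : c ≠ 0 := by rintro rfl; simp at hy; exact ha1' hy
  have hno : ∀ p : ℤ, Prime p → p ∣ a1.re → p ∣ a1.im → p ∣ B → False := by
    intro p hp e1 e2 e3
    obtain ⟨s, t, hst⟩ := h1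
    have e4 : (p : ℤ√d) ∣ a1 := (Zsqrtd.intCast_dvd _ _).2 ⟨e1, e2⟩
    have e5 : (p : ℤ√d) ∣ t * b - 1 := by
      have : t * b - 1 = - (s * a1) := by linear_combination hst
      rw [this, dvd_neg]; exact e4.mul_left _
    have e6 := zs_norm_cong e5
    rw [Zsqrtd.norm_mul, Zsqrtd.norm_one, ← hBdef] at e6
    have e7 := (dvd_sub_right (e3.mul_left t.norm)).1 e6
    exact hp.not_isUnit (isUnit_of_dvd_one e7)
  obtain ⟨a2, ha2⟩ : ∃ a2 : ℤ√d, a2 = ⟨a1.re + B * c, a1.im⟩ := ⟨_, rfl⟩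
  have hcop : IsCoprime a2.re a2.im := by
    rw [ha2]
    refine int_coprime_of_primes ha1' ?_
    intro p hp e1 e2
    simp only at e1 e2
    by_cases e3 : p ∣ a1.re
    · have e4 : p ∣ B * c := (dvd_add_right e3).1 e1
      rcases hp.dvd_or_dvd e4 with e5 | e5
      · exact hno p hp e3 e2 e5
      · obtain ⟨s, t, hst⟩ := hc
        have : p ∣ 1 := by rw [← hst]; exact dvd_add (e5.mul_left _) (e3.mul_left _)
        exact hp.not_isUnit (isUnit_of_dvd_one this)
    · rw [hy] at e2
      rcases hp.dvd_or_dvd e2 with e5 | e5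
      · exact e3 (hp.dvd_of_dvd_pow (e5.trans hu))
      · exact e3 ((dvd_add_left (e5.mul_left B)).1 e1)
  have ha21 : b ∣ a2 - a1 := by
    have : a2 - a1 = B * (c : ℤ√d) := by rw [ha2]; ext <;> simp
    rw [this]; exact hbB.mul_right _
  refine rch_congL ha21 ?_
  have h2 : IsCoprime a2 b := by
    obtain ⟨q, hq⟩ := ha21
    have : a2 = a1 + b * q := by linear_combination hq
    rw [this]; exact h1.add_mul_left_left q
  have him : a2.im ≠ 0 := by rw [ha2]; exact ha1'
  obtain ⟨N, hN⟩ : ∃ N, N = a2.norm := ⟨_, rfl⟩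
  have hN0 : N ≠ 0 := by
    intro h0
    rw [h0] at hN
    have := (Zsqrtd.norm_eq_zero hsq' a2).1 hN.symm
    rw [this] at him; simp at him
  have haN : a2 ∣ (N : ℤ√d) := ⟨star a2, by rw [hN, Zsqrtd.norm_eq_mul_conj]⟩
  have hNim : IsCoprime a2.im N := by
    have : N = a2.re * a2.re + a2.im * (-d * a2.im) := by rw [hN, Zsqrtd.norm_def]; ring
    rw [this]
    exact (hcop.symm.mul_right hcop.symm).add_mul_left_right _
  obtain ⟨y, m, hym⟩ := hNim
  obtain ⟨n, hn⟩ : ∃ n : ℤ, n = b.re - b.im * y * a2.re := ⟨_, rfl⟩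
  have hnb : a2 ∣ (n : ℤ√d) - b := by
    have e1 : (n : ℤ√d) - b = - (b.im : ℤ√d) * ((y : ℤ√d) * a2 + (m : ℤ√d) * (N : ℤ√d) * Zsqrtd.sqrtd) := by
      ext
      · simp [hn]; ring
      · simp; linear_combination -b.im * hym
    rw [e1]
    refine Dvd.dvd.mul_left (dvd_add (Dvd.intro_left _ rfl) ?_) _
    exact (haN.mul_left _).mul_right _
  have hnc : IsCoprime a2 (n : ℤ√d) := by
    obtain ⟨q, hq⟩ := hnb
    have : (n : ℤ√d) = b + a2 * q := by linear_combination hq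
    rw [this]; exact h2.add_mul_left_right q
  have hnN : IsCoprime N n := by rw [hN]; exact zs_norm_coprime hnc
  obtain ⟨n1, hn1, hn1c, t1, ht1⟩ : ∃ n1 : ℤ, Odd n1 ∧ IsCoprime N n1 ∧ N ∣ n1 - n := by
    rcases Int.even_or_odd n with he | ho
    · refine ⟨n + N, ?_, ?_, by simp⟩
      · refine he.add_odd ?_
        by_contra hne
        rw [Int.not_odd_iff_even] at hne
        obtain ⟨s, t, hst⟩ := hnN
        have : Even (1 : ℤ) := by rw [← hst]; exact (hne.mul_left _).add (he.mul_left _)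
        exact absurd this (by decide)
      · have := hnN.add_mul_left_right 1
        simpa using this
    · exact ⟨n, ho, hnN, by simp⟩
  have hn10 : n1 ≠ 0 := by rintro rfl; simp at hn1
  obtain ⟨n2, hn2⟩ : ∃ n2 : ℤ, n2 = n1 * (1 + 2 * N ^ 2) := ⟨_, rfl⟩
  have hdvd : a2 ∣ (n2 : ℤ√d) - b := by
    have : (n2 : ℤ√d) - b = ((n : ℤ√d) - b) + N * (t1 + 2 * N * n1) := by
      have e := congrArg (Int.cast (R := ℤ√d)) ht1
      rw [hn2]; push_cast at e ⊢
      linear_combination e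
    rw [this]
    exact dvd_add hnb (haN.mul_right _)
  refine rch_congR hdvd ?_
  apply core_lemma hd0 hsq
  · rw [hn2]; exact hn1.mul ⟨N ^ 2, by ring⟩
  · rw [hn2, Int.natAbs_mul]
    have e1 : 1 ≤ n1.natAbs := by omega
    have e2 : 1 < (1 + 2 * N ^ 2).natAbs := by
      have : 0 < N ^ 2 := by positivity
      omega
    nlinarith
  · obtain ⟨q, hq⟩ := hdvd
    have : (n2 : ℤ√d) = b + a2 * q := by linear_combination hq
    rw [this]; exact h2.add_mul_left_right q

end zthm

theorem rch_transfer {Z D : Type*} [CommRing Z] [CommRing D] (ι : Z →+* D)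
    (hinj : Function.Injective ι) (f : ℤ) (hfin : Finite (D ⧸ Ideal.span {((f : D) ^ 2)}))
    (hf : ∀ z : D, ∃ w : Z, (f : D) * z = ι w)
    (H : ∀ a b : Z, IsCoprime a b → Rch (a, b)) (a b : D) (h : IsCoprime a b) : Rch (a, b) := by
  obtain ⟨m, E, hE⟩ : ∃ m : ℕ, (f : D) ^ 2 ∣ a ^ (m + 1) * (a ^ (m + 1) - 1) := by
    obtain ⟨i, j, hij, he⟩ := Finite.exists_ne_map_eq_of_infinite
      (fun i : ℕ => Ideal.Quotient.mk (Ideal.span {((f : D) ^ 2)}) (a ^ i))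
    wlog hlt : i < j generalizing i j
    · exact this j i hij.symm he.symm (by omega)
    obtain ⟨k, rfl⟩ : ∃ k, j = i + (k + 1) := ⟨j - i - 1, by omega⟩
    have h1 := he.symm
    rw [Ideal.Quotient.eq, Ideal.mem_span_singleton] at h1
    refine ⟨(k + 1) * i + k, h1.trans ?_⟩
    have h2 : a ^ (i + (k + 1)) - a ^ i = a ^ i * (a ^ (k + 1) - 1) := by ring
    have h4 : (k + 1) * i + k + 1 = (k + 1) * (i + 1) := by ring
    rw [h2, h4]
    refine mul_dvd_mul (pow_dvd_pow _ (by nlinarith)) ?_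
    have h3 := sub_dvd_pow_sub_pow (a ^ (k + 1)) 1 (i + 1)
    rw [one_pow, ← pow_mul] at h3
    exact h3
  obtain ⟨s', t', hst⟩ := h.pow_left (m := m + 1)
  obtain ⟨e, he⟩ : ∃ e, e = a ^ (m + 1) := ⟨_, rfl⟩
  rw [← he] at hst hE
  have hae : a ∣ e := by rw [he]; exact dvd_pow_self _ (by omega)
  obtain ⟨b', hb'⟩ : ∃ b', b' = b + e * (1 - b) := ⟨_, rfl⟩
  have hb1 : a ∣ b' - b := by
    have : b' - b = e * (1 - b) := by rw [hb']; ring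
    rw [this]; exact hae.mul_right _
  refine rch_congR hb1 ?_
  have h1 : IsCoprime a b' := by
    obtain ⟨q, hq⟩ := hb1
    have : b' = b + a * q := by linear_combination hq
    rw [this]; exact h.add_mul_left_right q
  obtain ⟨bs, g, hbs⟩ : ∃ bs, (f : D) ^ 2 ∣ b' * bs - 1 := by
    refine ⟨e + (1 - e) * t', E * (2 - b + s' - s' * e - t'), ?_⟩
    rw [hb']
    linear_combination (2 - b + s' - s' * e - t') * hE + (1 - e) ^ 2 * hst
  obtain ⟨a1, ha1⟩ : ∃ a1, a1 = a + b' * bs * (1 - a) := ⟨_, rfl⟩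
  have hc1 : b' ∣ a1 - a := ⟨bs * (1 - a), by rw [ha1]; ring⟩
  refine rch_congL hc1 ?_
  have h2 : IsCoprime a1 b' := by
    obtain ⟨q, hq⟩ := hc1
    have : a1 = a + b' * q := by linear_combination hq
    rw [this]; exact h1.add_mul_left_left q
  have ha1' : a1 = 1 + f * (f * (g * (1 - a))) := by
    rw [ha1]; linear_combination (1 - a) * hbs
  obtain ⟨b1, hbb⟩ : ∃ b1, b1 = b' + a1 * (1 - b') := ⟨_, rfl⟩
  have hd1 : a1 ∣ b1 - b' := ⟨1 - b', by rw [hbb]; ring⟩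
  refine rch_congR hd1 ?_
  have h3 : IsCoprime a1 b1 := by
    obtain ⟨q, hq⟩ := hd1
    have : b1 = b' + a1 * q := by linear_combination hq
    rw [this]; exact h2.add_mul_left_right q
  have hb1' : b1 = 1 + f * (f * (g * (1 - a) * (1 - b'))) := by
    rw [hbb]; linear_combination (1 - b') * ha1'
  obtain ⟨w1, hw1⟩ := hf (g * (1 - a))
  obtain ⟨w2, hw2⟩ := hf (g * (1 - a) * (1 - b'))
  rw [hw1] at ha1'
  rw [hw2] at hb1'
  have e1 : a1 = ι (1 + f * w1) := by rw [ha1']; simp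
  have e2 : b1 = ι (1 + f * w2) := by rw [hb1']; simp
  obtain ⟨s, t, hst2⟩ := h3
  obtain ⟨s1, hs1⟩ := hf s
  obtain ⟨t1, ht1⟩ := hf t
  have e3 : s1 * (1 + f * w1) + t1 * (1 + f * w2) = (f : Z) := by
    apply hinj
    rw [map_add, map_mul, map_mul, ← e1, ← e2, ← hs1, ← ht1, map_intCast]
    linear_combination (f : D) * hst2
  have h4 : IsCoprime (1 + (f : Z) * w1) (1 + (f : Z) * w2) :=
    ⟨1 - w1 * s1, -w1 * t1, by linear_combination -w1 * e3⟩
  have h5 := rch_map ι (H _ _ h4)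
  rw [e1, e2]
  exact h5

theorem exists_conductor {Z D : Type*} [CommRing Z] [CommRing D] [Module.Finite ℤ D] (ι : Z →+* D)
    (h : ∀ z : D, ∃ f : ℤ, f ≠ 0 ∧ ∃ w : Z, (f : D) * z = ι w) :
    ∃ f : ℤ, f ≠ 0 ∧ ∀ z : D, ∃ w : Z, (f : D) * z = ι w := by
  obtain ⟨S, hS⟩ := (Module.Finite.fg_top : (⊤ : Submodule ℤ D).FG)
  choose g hg0 hg using h
  refine ⟨∏ z ∈ S, g z, Finset.prod_ne_zero_iff.2 fun z _ => hg0 z, fun z => ?_⟩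
  have hz : z ∈ Submodule.span ℤ (S : Set D) := by rw [hS]; trivial
  induction hz using Submodule.span_induction with
  | mem x hx =>
    obtain ⟨w, hw⟩ := hg x
    obtain ⟨c, hc⟩ := Finset.dvd_prod_of_mem g (Finset.mem_coe.1 hx)
    refine ⟨c * w, ?_⟩
    rw [hc, map_mul, map_intCast, ← hw]
    push_cast; ring
  | zero => exact ⟨0, by simp⟩
  | add x y _ _ hx hy =>
    obtain ⟨w, hw⟩ := hx
    obtain ⟨v, hv⟩ := hy
    exact ⟨w + v, by rw [map_add, ← hw, ← hv]; ring⟩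
  | smul c x _ hx =>
    obtain ⟨w, hw⟩ := hx
    exact ⟨c * w, by rw [map_mul, map_intCast, ← hw, zsmul_eq_mul]; ring⟩

theorem mem_qsqrt (d : ℕ) {x : ℝ} (hx : x ∈ ℚ⟮(Real.sqrt d)⟯) :
    ∃ r s : ℚ, x = r + s * Real.sqrt d := by
  have hd2 : Real.sqrt d * Real.sqrt d = d := Real.mul_self_sqrt (by positivity)
  have hint : IsIntegral ℚ (Real.sqrt d) := by
    refine ⟨Polynomial.X ^ 2 - Polynomial.C (d : ℚ), Polynomial.monic_X_pow_sub_C _ (by norm_num), ?_⟩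
    simp
  have hx' : x ∈ ℚ⟮(Real.sqrt d)⟯.toSubalgebra := hx
  rw [IntermediateField.adjoin_simple_toSubalgebra_of_isAlgebraic hint.isAlgebraic] at hx'
  clear hx
  induction hx' using Algebra.adjoin_induction with
  | mem y hy =>
    rw [Set.mem_singleton_iff] at hy
    exact ⟨0, 1, by rw [hy]; simp⟩
  | algebraMap r => exact ⟨r, 0, by simp⟩
  | add x y _ _ hx hy =>
    obtain ⟨r, s, h1⟩ := hx
    obtain ⟨r', s', h2⟩ := hy
    exact ⟨r + r', s + s', by rw [h1, h2]; push_cast; ring⟩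
  | mul x y _ _ hx hy =>
    obtain ⟨r, s, h1⟩ := hx
    obtain ⟨r', s', h2⟩ := hy
    refine ⟨r * r' + s * s' * d, r * s' + s * r', ?_⟩
    rw [h1, h2]; push_cast
    linear_combination (s : ℝ) * s' * hd2

theorem stmt_9 (d : ℕ) (hd : Squarefree d) (hd1 : 1 < d)
    (K : IntermediateField ℚ ℝ) (hK : K = ℚ⟮(Real.sqrt d)⟯) [NumberField K]
    (a b x y : NumberField.RingOfIntegers K) :
    IsIdemProd !![x * a, x * b; y * a, y * b] := by
  have hsq : ¬ IsSquare (d : ℤ) := by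
    rintro ⟨m, hm⟩
    have h1 : d = m.natAbs * m.natAbs := by
      have := congrArg Int.natAbs hm
      rw [Int.natAbs_mul] at this
      simpa using this
    have h2 := hd m.natAbs ⟨1, by rw [mul_one]; exact h1⟩
    rw [Nat.isUnit_iff] at h2
    rw [h2] at h1
    omega
  have hd2 : Real.sqrt d * Real.sqrt d = d := Real.mul_self_sqrt (by positivity)
  have hmem : Real.sqrt d ∈ K := by
    rw [hK]; exact IntermediateField.mem_adjoin_simple_self ℚ _
  obtain ⟨δK, hδK⟩ : ∃ δ : K, δ = ⟨Real.sqrt d, hmem⟩ := ⟨_, rfl⟩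
  have hδ2 : δK * δK = (d : K) := by
    rw [hδK]; apply Subtype.ext; simpa using hd2
  have hδint : IsIntegral ℤ δK := by
    refine ⟨Polynomial.X ^ 2 - Polynomial.C (d : ℤ), Polynomial.monic_X_pow_sub_C _ (by norm_num), ?_⟩
    simp [sq, hδ2]
  obtain ⟨δ, hδ⟩ : ∃ δ : NumberField.RingOfIntegers K, (δ : K) = δK := ⟨⟨δK, hδint⟩, rfl⟩
  have hδδ : δ * δ = ((d : ℤ) : NumberField.RingOfIntegers K) := by
    apply NumberField.RingOfIntegers.coe_injective
    push_cast
    simp [hδ, hδ2]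
  obtain ⟨ι, hιdef⟩ : ∃ ι, ι = Zsqrtd.lift (d := (d : ℤ)) ⟨δ, hδδ⟩ := ⟨_, rfl⟩
  have hinj : Function.Injective ι := by
    rw [hιdef]; exact Zsqrtd.lift_injective _ (fun n hn => hsq ⟨n, hn⟩)
  have hloc : ∀ z : NumberField.RingOfIntegers K, ∃ f : ℤ, f ≠ 0 ∧
      ∃ w : ℤ√(d : ℤ), (f : NumberField.RingOfIntegers K) * z = ι w := by
    intro z
    have hz : ((z : K) : ℝ) ∈ ℚ⟮(Real.sqrt d)⟯ := by rw [← hK]; exact (z : K).2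
    obtain ⟨r, s, hrs⟩ := mem_qsqrt d hz
    refine ⟨r.den * s.den, by simp, ⟨r.num * s.den, s.num * r.den⟩, ?_⟩
    apply NumberField.RingOfIntegers.coe_injective
    apply Subtype.ext
    rw [hιdef, Zsqrtd.lift_apply_apply]
    simp only [map_add, map_mul, map_intCast]
    push_cast
    have hδ' : algebraMap (NumberField.RingOfIntegers K) K δ = δK := hδ
    have hrs' : ((algebraMap (NumberField.RingOfIntegers K) K z : K) : ℝ) = r + s * Real.sqrt d := hrs
    rw [hδ', hδK, hrs']
    have e1 : (r.den : ℝ) * r = r.num := by exact_mod_cast Rat.den_mul_eq_num r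
    have e2 : (s.den : ℝ) * s = s.num := by exact_mod_cast Rat.den_mul_eq_num s
    linear_combination (s.den : ℝ) * e1 + (r.den : ℝ) * Real.sqrt d * e2
  obtain ⟨f, hf0, hf⟩ := exists_conductor ι hloc
  have hfin : Finite (NumberField.RingOfIntegers K ⧸
      Ideal.span {((f : NumberField.RingOfIntegers K) ^ 2)}) := by
    refine Ideal.finiteQuotientOfFreeOfNeBot _ ?_
    rw [Ne, Ideal.span_singleton_eq_bot]
    exact pow_ne_zero _ (by exact_mod_cast hf0)
  refine colrow_of_rch ?_ a b x y
  intro a b hab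
  exact rch_transfer ι hinj f hfin hf
    (fun a b h => rch_zsqrtd (by exact_mod_cast (by omega : 0 < d)) hsq h) a b hab
end

section
/- Let D be the ring of integers of a real quadratic number field and let M be a singular 2×2 matrix over D such that the ideal generated by the two entries of some row or some column of M is principal. Then M is a product of idempotent matrices over D. -/
open scoped IntermediateField

namespace RQ

section General
variable {R : Type*} [CommRing R]

/-- Two rows are adjacent if they form an invertible matrix. -/
def Adj (v w : R × R) : Prop := IsUnit (v.1 * w.2 - v.2 * w.1)

/-- A row reachable from `(1,0)` through adjacent rows. -/
def Reach (a b : R) : Prop := Relation.ReflTransGen Adj ((1 : R), (0 : R)) (a, b)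

lemma idem_mul {A B : Matrix (Fin 2) (Fin 2) R} (hA : IsIdemProd A) (hB : IsIdemProd B) :
    IsIdemProd (A * B) := by
  obtain ⟨l, hl, rfl⟩ := hA
  obtain ⟨k, hk, rfl⟩ := hB
  refine ⟨l ++ k, ?_, by simp⟩
  intro T hT
  rcases List.mem_append.1 hT with h | h
  · exact hl T h
  · exact hk T h

lemma idem_single {A : Matrix (Fin 2) (Fin 2) R} (hA : A * A = A) : IsIdemProd A :=
  ⟨[A], by simpa using hA, by simp⟩

lemma idem_transpose {A : Matrix (Fin 2) (Fin 2) R} (hA : IsIdemProd A) :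
    IsIdemProd A.transpose := by
  obtain ⟨l, hl, rfl⟩ := hA
  refine ⟨(l.map Matrix.transpose).reverse, ?_, Matrix.transpose_list_prod l⟩
  intro T hT
  simp only [List.mem_reverse, List.mem_map] at hT
  obtain ⟨S, hS, rfl⟩ := hT
  rw [← Matrix.transpose_mul, hl S hS]

lemma row_adj {a b x y : R} (h : IsUnit (a * y - b * x)) (hg : IsIdemProd !![a, b; 0, 0]) :
    IsIdemProd !![x, y; 0, 0] := by
  obtain ⟨u, hu⟩ := h
  have hu' : (↑u⁻¹ : R) * (a * y - b * x) = 1 := by rw [← hu]; simp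
  set e : R := ↑u⁻¹
  have key : !![x, y; 0, 0] = !![a, b; 0, 0] *
      !![e * (y - b) * x, e * (y - b) * y; e * (a - x) * x, e * (a - x) * y] := by
    ext i j
    fin_cases i <;> fin_cases j <;> simp [Matrix.mul_apply, Fin.sum_univ_two]
    · linear_combination (-x) * hu'
    · linear_combination (-y) * hu'
  rw [key]
  refine idem_mul hg (idem_single ?_)
  ext i j
  fin_cases i <;> fin_cases j <;> simp [Matrix.mul_apply, Fin.sum_univ_two]
  · linear_combination (e * (y - b) * x) * hu'
  · linear_combination (e * (y - b) * y) * hu'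
  · linear_combination (e * (a - x) * x) * hu'
  · linear_combination (e * (a - x) * y) * hu'

lemma reach_idem {a b : R} (h : Reach a b) : IsIdemProd !![a, b; 0, 0] := by
  suffices H : ∀ w : R × R, Relation.ReflTransGen Adj ((1 : R), (0 : R)) w →
      IsIdemProd !![w.1, w.2; 0, 0] from H (a, b) h
  intro w hw
  induction hw with
  | refl =>
    apply idem_single
    ext i j
    fin_cases i <;> fin_cases j <;> simp [Matrix.mul_apply, Fin.sum_univ_two]
  | tail _ h2 ih => exact row_adj h2 ih

lemma lift_adj {S : Type*} [CommRing S] (f : R × R → S × S)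
    (hf : ∀ v w, Adj v w → Adj (f v) (f w)) {v w : R × R}
    (h : Relation.ReflTransGen Adj v w) : Relation.ReflTransGen Adj (f v) (f w) := by
  induction h with
  | refl => exact .refl
  | tail _ h2 ih => exact .tail ih (hf _ _ h2)

lemma reach_of_gl {p q r s : R} (hdet : IsUnit (p * s - q * r)) (h0 : Reach p q) {a b : R}
    (h : Reach a b) : Reach (a * p + b * r) (a * q + b * s) := by
  have h1 := lift_adj
    (fun v : R × R => (v.1 * p + v.2 * r, v.1 * q + v.2 * s)) (by
      intro v w hvw
      unfold Adj at *
      convert hvw.mul hdet using 1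
      ring) h
  simp only [one_mul, zero_mul, add_zero] at h1
  exact Relation.ReflTransGen.trans h0 h1

lemma reach_one (t : R) : Reach 1 t := by
  unfold Reach
  refine Relation.ReflTransGen.trans (b := (0, 1)) (.single ?_) (.single ?_) <;>
  simp [Adj]

lemma reach_u0 {u : R} (hu : IsUnit u) : Reach u 0 := by
  unfold Reach
  refine Relation.ReflTransGen.trans (b := (0, 1)) (.single ?_) (.single ?_) <;>
  simp [Adj, hu]

lemma reach_addr (t : R) {a b : R} (h : Reach a b) : Reach a (b + t * a) := by
  have := reach_of_gl (p := 1) (q := t) (r := 0) (s := 1) (by simp) (reach_one t) h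
  convert this using 1 <;> ring

lemma reach_swap {a b : R} (h : Reach a b) : Reach b a := by
  have h01 : Reach (0 : R) 1 := .single (by simp [Adj])
  have := reach_of_gl (p := 0) (q := 1) (r := 1) (s := 0) (by simp) h01 h
  convert this using 1 <;> ring

lemma reach_unit {u a b : R} (hu : IsUnit u) (h : Reach a b) : Reach (u * a) b := by
  have := reach_of_gl (p := u) (q := 0) (r := 0) (s := 1) (by simpa using hu) (reach_u0 hu) h
  convert this using 1 <;> ring

lemma reach_of_dvd_sub {a b b' : R} (hd : a ∣ b - b') (h : Reach a b) : Reach a b' := by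
  obtain ⟨t, ht⟩ := hd
  have := reach_addr (-t) h
  convert this using 1
  linear_combination -ht

lemma reach_of_dvd_sub' {a a' b : R} (hd : b ∣ a - a') (h : Reach a b) : Reach a' b :=
  reach_swap (reach_of_dvd_sub hd (reach_swap h))

lemma reach_unit_iff {u a b : R} (hu : IsUnit u) : Reach (u * a) b ↔ Reach a b := by
  refine ⟨fun h => ?_, reach_unit hu⟩
  obtain ⟨u, rfl⟩ := hu
  have := reach_unit (u⁻¹).isUnit h
  simpa using this

lemma reach_of_unit {u b : R} (hu : IsUnit u) : Reach u b := by
  have := reach_unit hu (reach_one b)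
  simpa using this

lemma reach_ringEquiv {S : Type*} [CommRing S] (e : R ≃+* S) {a b : R}
    (h : Reach (e a) (e b)) : Reach a b := by
  have h1 := lift_adj
    (fun v : S × S => (e.symm v.1, e.symm v.2)) (by
      intro v w hvw
      unfold Adj at *
      have := hvw.map e.symm
      simpa using this) h
  simpa [Reach] using h1

end General

section Dedekind
variable {D : Type*} [CommRing D] [IsDedekindDomain D]

/-- Every row is the image of a unimodular row under an idempotent. -/
lemma exists_unimod (a b : D) : ∃ (v w : D) (T : Matrix (Fin 2) (Fin 2) D), IsCoprime v w ∧
    T * T = T ∧ !![a, b; 0, 0] = !![v, w; 0, 0] * T := by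
  by_cases ha : a = 0
  · subst ha
    refine ⟨1, b, !![0, 0; 0, 1], isCoprime_one_left, ?_, ?_⟩ <;>
    · ext i j
      fin_cases i <;> fin_cases j <;> simp [Matrix.mul_apply, Fin.sum_univ_two]
  set I : Ideal D := Ideal.span {a, b} with hI
  have haI : a ∈ I := Ideal.subset_span (by simp)
  have hbI : b ∈ I := Ideal.subset_span (by simp)
  have hI0 : I ≠ 0 := by
    intro h
    rw [h] at haI
    exact ha (by simpa using haI)
  have hle : Ideal.span {a} ≤ I := (Ideal.span_singleton_le_iff_mem I).2 haI
  obtain ⟨J, hJ⟩ := Ideal.dvd_iff_le.2 hle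
  have haIJ : a ∈ I * J := by rw [← hJ]; exact Ideal.mem_span_singleton_self a
  have hex : ∃ p ∈ J, ∃ r ∈ J, a * p + b * r = a := by
    rw [hI, Ideal.span_insert, Ideal.sup_mul, Submodule.mem_sup] at haIJ
    obtain ⟨y, hy, z, hz, hyz⟩ := haIJ
    rw [Ideal.mem_span_singleton_mul] at hy hz
    obtain ⟨p, hp, rfl⟩ := hy
    obtain ⟨r, hr, rfl⟩ := hz
    exact ⟨p, hp, r, hr, hyz⟩
  obtain ⟨p, hp, r, hr, hpr⟩ := hex
  have hb : ∀ z ∈ J, ∃ q, b * z = a * q := by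
    intro z hz
    have : b * z ∈ I * J := Ideal.mul_mem_mul hbI hz
    rw [← hJ, Ideal.mem_span_singleton] at this
    exact this
  obtain ⟨q, hq⟩ := hb p hp
  obtain ⟨s, hs⟩ := hb r hr
  have hps : p + s = 1 := by
    apply mul_left_cancel₀ ha
    linear_combination hpr - hs
  have hdet : p * s = q * r := by
    apply mul_left_cancel₀ ha
    linear_combination (-p) * hs + r * hq
  obtain ⟨t, ht⟩ := IsDedekindDomain.exists_sup_span_eq (I := I ^ 2) (J := I)
    (Ideal.pow_le_self two_ne_zero) (pow_ne_zero 2 hI0)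
  have htI : t ∈ I := by
    rw [← ht]
    exact Ideal.mem_sup_right (Ideal.mem_span_singleton_self t)
  obtain ⟨x, y, hxy⟩ := Ideal.mem_span_pair.1 htI
  refine ⟨a + (x * r + y * s), b - (x * p + y * q), !![p, q; r, s], ?_, ?_, ?_⟩
  · rw [← Ideal.isCoprime_span_singleton_iff, Ideal.isCoprime_iff_sup_eq]
    by_contra hne
    obtain ⟨P, hP, hle⟩ := Ideal.exists_le_maximal _ hne
    have hv : a + (x * r + y * s) ∈ P :=
      hle (Ideal.mem_sup_left (Ideal.mem_span_singleton_self _))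
    have hw : b - (x * p + y * q) ∈ P :=
      hle (Ideal.mem_sup_right (Ideal.mem_span_singleton_self _))
    have hs1 : s = 1 - p := by linear_combination hps
    have hbs : b * s = b - a * q := by rw [hs1]; linear_combination -hq
    have haP : a ∈ P := by
      have := P.add_mem (P.mul_mem_right p hv) (P.mul_mem_right r hw)
      convert this using 1
      linear_combination (-1 : D) * hpr - y * hdet
    have hbP : b ∈ P := by
      have := P.add_mem (P.mul_mem_right q hv) (P.mul_mem_right s hw)
      convert this using 1
      linear_combination (-1 : D) * hbs + x * hdet
    have hIP : I ≤ P := by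
      rw [hI, Ideal.span_le]
      intro z hz
      rcases hz with rfl | rfl
      · exact haP
      · exact hbP
    have h1 : x * r + y * s ∈ P := by
      have := P.sub_mem hv haP
      convert this using 1; ring
    have h2 : x * p + y * q ∈ P := by
      have := P.sub_mem hbP hw
      convert this using 1; ring
    have hsq : ∀ z ∈ I ^ 2, ∀ k ∈ J, ∃ g ∈ P, z * k = a * g := by
      intro z hz k hk
      have : z * k ∈ I * (I * J) := by
        rw [← mul_assoc, ← pow_two]
        exact Ideal.mul_mem_mul hz hk
      rw [← hJ, mul_comm, Ideal.mem_span_singleton_mul] at this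
      obtain ⟨g, hg, hg2⟩ := this
      exact ⟨g, hIP hg, hg2.symm⟩
    have hdec : ∀ z ∈ I, ∃ m ∈ I ^ 2, ∃ l, z = m + l * t := by
      intro z hz
      rw [← ht, Submodule.mem_sup] at hz
      obtain ⟨m, hm, n, hn, rfl⟩ := hz
      obtain ⟨l, rfl⟩ := Ideal.mem_span_singleton'.1 hn
      exact ⟨m, hm, l, rfl⟩
    obtain ⟨m, hm, l, hl⟩ := hdec a haI
    obtain ⟨m', hm', l', hl'⟩ := hdec b hbI
    obtain ⟨g, hg, hg2⟩ := hsq m hm p hp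
    obtain ⟨g', hg', hg2'⟩ := hsq m' hm' r hr
    have : (1 : D) = g + g' + l * (x * p + y * q) + l' * (x * r + y * s) := by
      apply mul_left_cancel₀ ha
      linear_combination -hpr + p * hl + r * hl' + hg2 + hg2' - l * p * hxy - l' * r * hxy
        + l * y * hq + l' * y * hs
    apply hP.ne_top
    rw [Ideal.eq_top_iff_one, this]
    exact P.add_mem (P.add_mem (P.add_mem hg hg') (P.mul_mem_left _ h2)) (P.mul_mem_left _ h1)
  · have hs1 : s = 1 - p := by linear_combination hps
    ext i j
    fin_cases i <;> fin_cases j <;> simp [Matrix.mul_apply, Fin.sum_univ_two]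
    · linear_combination (-1 : D) * hdet + p * hps
    · linear_combination q * hps
    · linear_combination r * hps
    · linear_combination (-1 : D) * hdet + s * hps
  · have hs1 : s = 1 - p := by linear_combination hps
    have hbs : b * s = b - a * q := by rw [hs1]; linear_combination -hq
    ext i j
    fin_cases i <;> fin_cases j <;> simp [Matrix.mul_apply, Fin.sum_univ_two]
    · linear_combination (-1 : D) * hpr - y * hdet
    · linear_combination (-1 : D) * hbs + x * hdet

lemma row_idem (H : ∀ a b : D, IsCoprime a b → Reach a b) (a b : D) :
    IsIdemProd !![a, b; 0, 0] := by
  obtain ⟨v, w, T, hc, hT, h⟩ := exists_unimod a b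
  rw [h]
  exact idem_mul (reach_idem (H v w hc)) (idem_single hT)

lemma col_idem (H : ∀ a b : D, IsCoprime a b → Reach a b) (a b : D) :
    IsIdemProd !![a, 0; b, 0] := by
  have := idem_transpose (row_idem H a b)
  convert this using 1
  ext i j
  fin_cases i <;> fin_cases j <;> simp

/-- Given a principal row `(a,b)` the singular matrix with other row `(c,d)` splits. -/
lemma split_row (a b c d : D) (hdet : a * d = b * c) (h0 : ¬ (a = 0 ∧ b = 0))
    (hp : (Ideal.span {a, b}).IsPrincipal) :
    ∃ g a' b' t, a = g * a' ∧ b = g * b' ∧ c = t * a' ∧ d = t * b' := by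
  obtain ⟨g, hg⟩ := hp
  rw [← Ideal.span, ] at hg
  have ha : a ∈ Ideal.span {g} := hg ▸ Ideal.subset_span (by simp)
  have hb : b ∈ Ideal.span {g} := hg ▸ Ideal.subset_span (by simp)
  have hgg : g ∈ Ideal.span {a, b} := by rw [hg]; exact Ideal.mem_span_singleton_self g
  obtain ⟨a', rfl⟩ := Ideal.mem_span_singleton.1 ha
  obtain ⟨b', rfl⟩ := Ideal.mem_span_singleton.1 hb
  obtain ⟨x, y, hxy⟩ := Ideal.mem_span_pair.1 hgg
  have hg0 : g ≠ 0 := by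
    rintro rfl
    simp at h0
  have h1 : x * a' + y * b' = 1 := by
    apply mul_left_cancel₀ hg0
    linear_combination hxy
  have h2 : a' * d = b' * c := by
    apply mul_left_cancel₀ hg0
    linear_combination hdet
  refine ⟨g, a', b', x * c + y * d, rfl, rfl, ?_, ?_⟩
  · linear_combination (-c) * h1 - y * h2
  · linear_combination (-d) * h1 + x * h2

lemma main_row (H : ∀ a b : D, IsCoprime a b → Reach a b)
    (M : Matrix (Fin 2) (Fin 2) D) (hdet : M.det = 0)
    (hp : ∃ i, (Ideal.span {M i 0, M i 1}).IsPrincipal) : IsIdemProd M := by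
  have key : ∀ x y a b : D, M = !![x * a, x * b; y * a, y * b] → IsIdemProd M := by
    intro x y a b h
    have : M = !![x, 0; y, 0] * !![a, b; 0, 0] := by
      rw [h]
      ext i j
      fin_cases i <;> fin_cases j <;> simp [Matrix.mul_apply, Fin.sum_univ_two]
    rw [this]
    exact idem_mul (col_idem H x y) (row_idem H a b)
  rw [Matrix.det_fin_two] at hdet
  have hM := Matrix.eta_fin_two M
  obtain ⟨i, hi⟩ := hp
  fin_cases i
  · by_cases h0 : M 0 0 = 0 ∧ M 0 1 = 0
    · apply key 0 1 (M 1 0) (M 1 1)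
      rw [hM]; simp [h0]
    · obtain ⟨g, a, b, t, h1, h2, h3, h4⟩ := split_row (M 0 0) (M 0 1) (M 1 0) (M 1 1)
        (by linear_combination hdet) h0 hi
      apply key g t a b
      rw [hM, h1, h2, h3, h4]
  · by_cases h0 : M 1 0 = 0 ∧ M 1 1 = 0
    · apply key 1 0 (M 0 0) (M 0 1)
      rw [hM]; simp [h0]
    · obtain ⟨g, a, b, t, h1, h2, h3, h4⟩ := split_row (M 1 0) (M 1 1) (M 0 0) (M 0 1)
        (by linear_combination (-1 : D) * hdet) h0 hi
      apply key t g a b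
      rw [hM, h1, h2, h3, h4]

lemma main_general (H : ∀ a b : D, IsCoprime a b → Reach a b)
    (M : Matrix (Fin 2) (Fin 2) D) (hdet : M.det = 0)
    (hp : (∃ i, (Ideal.span {M i 0, M i 1}).IsPrincipal) ∨
              (∃ j, (Ideal.span {M 0 j, M 1 j}).IsPrincipal)) : IsIdemProd M := by
  rcases hp with hp | hp
  · exact main_row H M hdet hp
  · have := idem_transpose (main_row H M.transpose (by rw [Matrix.det_transpose, hdet]) (by
      simpa using hp))
    simpa using this

end Dedekind
end RQ

namespace RQ
section Ints

lemma icop {a b : ℤ} (h : ∀ p : ℕ, p.Prime → (p : ℤ) ∣ a → (p : ℤ) ∣ b → False) :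
    IsCoprime a b := by
  rw [Int.isCoprime_iff_gcd_eq_one]
  by_contra hne
  obtain ⟨p, hp, hpd⟩ := Nat.exists_prime_and_dvd hne
  exact h p hp ((Int.natCast_dvd_natCast.2 hpd).trans (Int.gcd_dvd_left _ _))
    ((Int.natCast_dvd_natCast.2 hpd).trans (Int.gcd_dvd_right _ _))

lemma icop_prime {a b : ℤ} (h : IsCoprime a b) {p : ℕ} (hp : p.Prime) (ha : (p : ℤ) ∣ a)
    (hb : (p : ℤ) ∣ b) : False := by
  have := h.isUnit_of_dvd' ha hb
  rw [Int.isUnit_iff_natAbs_eq] at this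
  simp at this
  exact hp.one_lt.ne' this

lemma prime_dvd_prod {s : Finset ℕ} (hs : ∀ p ∈ s, p.Prime) {q : ℕ} (hq : q.Prime) :
    (q : ℤ) ∣ ((∏ p ∈ s, p : ℕ) : ℤ) ↔ q ∈ s := by
  rw [Int.natCast_dvd_natCast]
  constructor
  · intro h
    obtain ⟨p, hp, hqp⟩ := (Nat.Prime.prime hq).exists_mem_finset_dvd h
    rw [(Nat.prime_dvd_prime_iff_eq hq (hs p hp)).1 hqp]
    exact hp
  · intro h
    exact Finset.dvd_prod_of_mem _ h

open Classical in
lemma shift_coprime {x y m : ℤ} (hx : x ≠ 0)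
    (h : ∀ p : ℕ, p.Prime → (p : ℤ) ∣ x → (p : ℤ) ∣ y → (p : ℤ) ∣ m → False) :
    ∃ k, IsCoprime x (y + m * k) := by
  set s : Finset ℕ := x.natAbs.primeFactors.filter (fun p : ℕ => ¬ ((p : ℤ) ∣ y)) with hs
  have hsp : ∀ p ∈ s, p.Prime := by
    intro p hp
    rw [hs, Finset.mem_filter] at hp
    exact Nat.prime_of_mem_primeFactors hp.1
  refine ⟨((∏ p ∈ s, p : ℕ) : ℤ), icop ?_⟩
  intro p hp h1 h2
  have hpI : Prime (p : ℤ) := Nat.prime_iff_prime_int.1 hp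
  by_cases hy : (p : ℤ) ∣ y
  · rw [dvd_add_right hy] at h2
    rcases hpI.dvd_or_dvd h2 with h3 | h3
    · exact h p hp h1 hy h3
    · rw [prime_dvd_prod hsp hp, hs, Finset.mem_filter] at h3
      exact h3.2 hy
  · have : (p : ℤ) ∣ ((∏ p ∈ s, p : ℕ) : ℤ) := by
      rw [prime_dvd_prod hsp hp, hs, Finset.mem_filter, Nat.mem_primeFactors]
      exact ⟨⟨hp, Int.natCast_dvd.1 h1, by simpa using hx⟩, hy⟩
    rw [dvd_add_left (this.mul_left m)] at h2
    exact hy h2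

open Classical in
lemma coprime_part {m : ℤ} (hm : m ≠ 0) (n : ℤ) : ∃ D : ℤ, D ≠ 0 ∧ IsCoprime D n ∧
    ∀ p : ℕ, p.Prime → (p : ℤ) ∣ m → (p : ℤ) ∣ n ∨ (p : ℤ) ∣ D := by
  set s : Finset ℕ := m.natAbs.primeFactors.filter (fun p : ℕ => ¬ ((p : ℤ) ∣ n)) with hs
  have hsp : ∀ p ∈ s, p.Prime := by
    intro p hp
    rw [hs, Finset.mem_filter] at hp
    exact Nat.prime_of_mem_primeFactors hp.1
  refine ⟨((∏ p ∈ s, p : ℕ) : ℤ), ?_, icop ?_, ?_⟩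
  · rw [Nat.cast_ne_zero, Finset.prod_ne_zero_iff]
    intro p hp
    exact (hsp p hp).ne_zero
  · intro p hp h1 h2
    rw [prime_dvd_prod hsp hp, hs, Finset.mem_filter] at h1
    exact h1.2 h2
  · intro p hp h
    by_cases hn : (p : ℤ) ∣ n
    · exact Or.inl hn
    · right
      rw [prime_dvd_prod hsp hp, hs, Finset.mem_filter, Nat.mem_primeFactors]
      exact ⟨⟨hp, Int.natCast_dvd.1 h, by simpa using hm⟩, hn⟩

/-- the norm form -/
def F (c t x y : ℤ) : ℤ := x * x + t * x * y - c * y * y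

lemma F_congr (c t : ℤ) {x x' y y' n : ℤ} (hx : n ∣ x - x') (hy : n ∣ y - y') :
    n ∣ F c t x y - F c t x' y' := by
  obtain ⟨a, ha⟩ := hx
  obtain ⟨b, hb⟩ := hy
  obtain rfl : x = x' + n * a := by linear_combination ha
  obtain rfl : y = y' + n * b := by linear_combination hb
  refine ⟨2 * x' * a + n * a * a + t * (x' * b + a * y' + n * a * b)
    - c * (2 * y' * b + n * b * b), ?_⟩
  unfold F; ring

lemma coprime_congr {n A B : ℤ} (h : n ∣ A - B) (hB : IsCoprime B n) : IsCoprime A n := by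
  obtain ⟨k, hk⟩ := h
  obtain rfl : A = B + n * k := by linear_combination hk
  exact IsCoprime.add_mul_left_left hB k

lemma base_pair (c t : ℤ) {n m x0 y0 : ℤ} (hn : n ≠ 0) (hm : m ≠ 0)
    (h0 : IsCoprime (F c t x0 y0) n) :
    ∃ x y, n ∣ x - x0 ∧ n ∣ y - y0 ∧ IsCoprime x y ∧ IsCoprime (F c t x y) m ∧
      IsCoprime (F c t x y) n := by
  obtain ⟨D, hD0, hD, hDm⟩ := coprime_part hm n
  obtain ⟨u, v, huv⟩ := hD
  obtain ⟨x, hx0, hxn, hxD⟩ : ∃ x, x ≠ 0 ∧ n ∣ x - x0 ∧ D ∣ x - 1 := by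
    have h1 : n ∣ (x0 * (u * D) + v * n) - x0 := ⟨v - x0 * v, by linear_combination x0 * huv⟩
    have h2 : D ∣ (x0 * (u * D) + v * n) - 1 := ⟨x0 * u - u, by linear_combination huv⟩
    by_cases hz : x0 * (u * D) + v * n = 0
    · refine ⟨x0 * (u * D) + v * n + n * D, ?_, ?_, ?_⟩
      · rw [hz]; simpa using ⟨hn, hD0⟩
      · rw [add_sub_right_comm]
        exact dvd_add h1 (dvd_mul_right n D)
      · rw [add_sub_right_comm]
        exact dvd_add h2 (dvd_mul_left D n)
    · exact ⟨_, hz, h1, h2⟩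
  set y1 := y0 * (u * D) with hy1
  have hy1n : n ∣ y1 - y0 := ⟨-(y0 * v), by rw [hy1]; linear_combination y0 * huv⟩
  have hy1D : D ∣ y1 := ⟨y0 * u, by rw [hy1]; ring⟩
  have hFn : ∀ y, n ∣ y - y0 → IsCoprime (F c t x y) n := fun y hy =>
    coprime_congr (F_congr c t hxn hy) h0
  obtain ⟨k, hk⟩ := shift_coprime (x := x) (y := y1) (m := n * D) hx0 (by
    intro p hp h1 h2 h3
    rcases (Nat.prime_iff_prime_int.1 hp).dvd_or_dvd h3 with h4 | h4
    · refine icop_prime (hFn y1 hy1n) hp ?_ h4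
      unfold F
      exact dvd_sub (dvd_add (h1.mul_right _) (h2.mul_left _)) (h2.mul_left _)
    · have h5 : (p : ℤ) ∣ 1 := by
        have := dvd_sub h1 (h4.trans hxD)
        simpa using this
      exact icop_prime isCoprime_one_left hp h5 h5)
  have hyn : n ∣ (y1 + n * D * k) - y0 := by
    rw [add_sub_right_comm, mul_assoc]
    exact dvd_add hy1n (dvd_mul_right n (D * k))
  have hyD : D ∣ y1 + n * D * k := dvd_add hy1D ⟨n * k, by ring⟩
  refine ⟨x, _, hxn, hyn, hk, icop ?_, hFn _ hyn⟩
  intro p hp h1 h2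
  rcases hDm p hp h2 with h3 | h3
  · exact icop_prime (hFn _ hyn) hp h1 h3
  · have h5 := F_congr c t (x := x) (x' := 1) (y := y1 + n * D * k) (y' := 0) (n := D) hxD
      (by simpa using hyD)
    have h6 := dvd_sub h1 (h3.trans h5)
    have h7 : (p : ℤ) ∣ 1 := by
      have e : F c t x (y1 + n * D * k) - (F c t x (y1 + n * D * k) - F c t 1 0) = 1 := by
        simp [F]
      rwa [e] at h6
    exact icop_prime isCoprime_one_left hp h7 h7

lemma exists_shift_ge {s : ℤ} (hs : s ≠ 0) (y B : ℤ) : ∃ k, B ≤ y + s * k := by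
  refine ⟨s.sign * (|B| + |y|), ?_⟩
  have h1 : s * (s.sign * (|B| + |y|)) = |s| * (|B| + |y|) := by
    rw [← mul_assoc, mul_comm s, Int.sign_mul_self, Int.natCast_natAbs]
  have h2 : 1 ≤ |s| := Int.one_le_abs hs
  have h3 := le_abs_self B
  have h4 := neg_abs_le y
  have h5 := abs_nonneg B
  have h6 := abs_nonneg y
  rw [h1]
  nlinarith

lemma sign_pair {c : ℤ} (hc : 0 < c) (t : ℤ) {n m x0 y0 : ℤ} (hn : n ≠ 0) (hm : m ≠ 0)
    (hnm : Even (n * m)) (h0 : IsCoprime (F c t x0 y0) n) :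
    ∃ x y, n ∣ x - x0 ∧ n ∣ y - y0 ∧ IsCoprime x y ∧ IsCoprime (F c t x y) m ∧
      IsCoprime (F c t x y) n ∧ (F c t x y).natAbs % 4 = 3 := by
  obtain ⟨x, y, h1, h2, h3, h4, h5⟩ := base_pair c t hn hm h0
  have hodd : F c t x y % 2 = 1 := by
    rcases Int.emod_two_eq_zero_or_one (F c t x y) with h | h
    · exfalso
      refine icop_prime (h5.mul_right h4) Nat.prime_two (Int.dvd_of_emod_eq_zero h) ?_
      exact hnm.two_dvd
    · exact h
  have gen : ∀ x' y' : ℤ, 4 * n * m ∣ x' - x → 4 * n * m ∣ y' - y → IsCoprime x' y' →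
      (F c t x' y').natAbs % 4 = 3 → ∃ x y, n ∣ x - x0 ∧ n ∣ y - y0 ∧ IsCoprime x y ∧
      IsCoprime (F c t x y) m ∧ IsCoprime (F c t x y) n ∧ (F c t x y).natAbs % 4 = 3 := by
    intro x' y' hx hy hxy hF
    have hdn : n ∣ 4 * n * m := ⟨4 * m, by ring⟩
    have hdm : m ∣ 4 * n * m := ⟨4 * n, by ring⟩
    refine ⟨x', y', ?_, ?_, hxy, ?_, ?_, hF⟩
    · have := dvd_add (hdn.trans hx) h1
      simpa using this
    · have := dvd_add (hdn.trans hy) h2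
      simpa using this
    · exact coprime_congr (hdm.trans (F_congr c t hx hy)) h4
    · exact coprime_congr (hdn.trans (F_congr c t hx hy)) h5
  have hS : 4 * n * m ≠ 0 := by simp [hn, hm]
  have h4S : (4 : ℤ) ∣ 4 * n * m := ⟨n * m, by ring⟩
  by_cases hcase : (F c t x y).natAbs % 4 = 3
  · exact gen x y (by simp) (by simp) h3 hcase
  rcases le_or_gt 0 (F c t x y) with hpos | hneg
  · have hx0 : x ≠ 0 := by
      rintro rfl
      have hy0 : y ≠ 0 := by
        rintro rfl
        exact not_isCoprime_zero_zero h3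
      have : 0 < y * y := mul_self_pos.2 hy0
      unfold F at hpos
      nlinarith
    obtain ⟨k, hk⟩ := exists_shift_ge (mul_ne_zero hS hx0) y (|x| * (|t| + 1) + 1)
    set y' := y + 4 * n * m * x * k with hy'
    have hyS : 4 * n * m ∣ y' - y := ⟨x * k, by rw [hy']; ring⟩
    have hmod := h4S.trans (F_congr c t (x := x) (x' := x) (by simp) hyS)
    have hF : F c t x y' < 0 := by
      unfold F
      have e1 : t * x ≤ |t| * |x| := by rw [← abs_mul]; exact le_abs_self _
      have e2 : x * x = |x| * |x| := (abs_mul_abs_self x).symm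
      have e3 := abs_nonneg x
      have e4 := abs_nonneg t
      have e5 : |x| ≤ y' := by nlinarith
      have e6 : 0 < y' := by nlinarith
      have e7 : t * x * y' ≤ |t| * |x| * y' := mul_le_mul_of_nonneg_right e1 e6.le
      have e8 : |x| * |x| ≤ |x| * y' := mul_le_mul_of_nonneg_left e5 e3
      have e9 : (|x| * (|t| + 1) + 1) * y' ≤ y' * y' := mul_le_mul_of_nonneg_right hk e6.le
      have e10 : y' * y' ≤ c * y' * y' := by nlinarith [mul_pos e6 e6]
      nlinarith
    refine gen x y' (by simp) hyS ?_ (by omega)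
    rw [show y' = y + x * (4 * n * m * k) from by rw [hy']; ring]
    exact IsCoprime.add_mul_left_right h3 (4 * n * m * k)
  · have hy0 : y ≠ 0 := by
      rintro rfl
      unfold F at hneg
      nlinarith [mul_self_nonneg x]
    obtain ⟨k, hk⟩ := exists_shift_ge (mul_ne_zero hS hy0) x (|y| * (|t| + c + 1) + 1)
    set x' := x + 4 * n * m * y * k with hx'
    have hxS : 4 * n * m ∣ x' - x := ⟨y * k, by rw [hx']; ring⟩
    have hmod := h4S.trans (F_congr c t (y := y) (y' := y) hxS (by simp))
    have hF : 0 < F c t x' y := by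
      unfold F
      have e1 : -(|t| * |y|) ≤ t * y := by rw [← abs_mul]; exact neg_abs_le _
      have e2 : y * y = |y| * |y| := (abs_mul_abs_self y).symm
      have e3 := abs_nonneg y
      have e4 := abs_nonneg t
      have e4' := mul_nonneg e3 e4
      have e4'' := mul_nonneg e3 hc.le
      have e5 : |y| ≤ x' := by nlinarith
      have e6 : 0 < x' := by nlinarith
      have e7 : -(|t| * |y|) * x' ≤ t * y * x' := mul_le_mul_of_nonneg_right e1 e6.le
      have e8 : c * |y| * |y| ≤ c * |y| * x' :=
        mul_le_mul_of_nonneg_left e5 (mul_nonneg hc.le e3)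
      have e9 : (|y| * (|t| + c + 1) + 1) * x' ≤ x' * x' := mul_le_mul_of_nonneg_right hk e6.le
      have e10 : 0 ≤ |y| * x' := mul_nonneg e3 e6.le
      have e11 : c * y * y = c * |y| * |y| := by rw [mul_assoc, e2]; ring
      nlinarith
    refine gen x' y hxS (by simp) ?_ (by omega)
    rw [show x' = x + y * (4 * n * m * k) from by rw [hx']; ring]
    exact IsCoprime.add_mul_left_left h3 (4 * n * m * k)

/-- binomial expansion to second order -/
lemma pow_expand (X : ℤ) (i : ℕ) : ∃ r, (1 + X) ^ i = 1 + i * X + X * X * r := by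
  induction i with
  | zero => exact ⟨0, by simp⟩
  | succ i ih =>
    obtain ⟨r, hr⟩ := ih
    refine ⟨i + r + X * r, ?_⟩
    rw [pow_succ, hr]
    push_cast
    ring

lemma pow_expand3 (X : ℤ) (i : ℕ) :
    ∃ q r : ℤ, 2 * q = i * (i - 1) ∧ (1 + X) ^ i = 1 + i * X + q * (X * X) + X * X * X * r := by
  induction i with
  | zero => exact ⟨0, 0, by simp, by simp⟩
  | succ i ih =>
    obtain ⟨q, r, hq, hr⟩ := ih
    refine ⟨q + i, q + r + X * r, ?_, ?_⟩
    · push_cast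
      linear_combination hq
    · rw [pow_succ, hr]
      push_cast
      ring

lemma lift_power {N : ℕ} (hN : Odd N) {w u : ℤ} (hw : (N : ℤ) ∣ w) (hu : IsCoprime u N) (k : ℕ) :
    ∃ u' : ℤ, IsCoprime u' N ∧ (1 + w * u) ^ (N ^ k) = 1 + w * N ^ k * u' := by
  induction k with
  | zero => exact ⟨u, hu, by simp⟩
  | succ k ih =>
    obtain ⟨u', hu', h⟩ := ih
    obtain ⟨q, r, hq, hr⟩ := pow_expand3 (w * N ^ k * u') N
    obtain ⟨e, he⟩ := hN
    obtain ⟨w', hw'⟩ := hw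
    have hq' : q = N * e := by
      have : (N : ℤ) = 2 * e + 1 := by exact_mod_cast he
      have h2 : 2 * q = 2 * (N * e) := by
        rw [hq]; linear_combination (N : ℤ) * this
      linarith
    refine ⟨u' * (1 + N * (e * w' * N ^ k * u' + w' * w' * N ^ k * N ^ k * u' * u' * r)), ?_, ?_⟩
    · refine IsCoprime.mul_left hu' ?_
      exact IsCoprime.add_mul_left_left isCoprime_one_left _
    · rw [pow_succ, pow_mul, h, hr, hq', hw']
      ring

lemma hit {N : ℕ} (hN : Odd N) {w u : ℤ} (hw0 : w ≠ 0) (hw : (N : ℤ) ∣ w) (hu : IsCoprime u N) (z : ℤ)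
    (hz : w ∣ z - 1) (k : ℕ) : ∃ j : ℕ, w * N ^ k ∣ (1 + w * u) ^ j - z := by
  induction k with
  | zero =>
    refine ⟨0, ?_⟩
    have := (dvd_neg (α := ℤ)).2 hz
    simpa using this
  | succ k ih =>
    obtain ⟨j, s, hs⟩ := ih
    obtain ⟨u', hu', h⟩ := lift_power hN hw hu k
    obtain ⟨a, b, hab⟩ := hu'
    obtain ⟨i, l, hi⟩ : ∃ (i : ℕ) (l : ℤ), (i : ℤ) = -(s * a) + N * l := by
      have hN0 : (N : ℤ) ≠ 0 := by
        obtain ⟨e, he⟩ := hN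
        exact_mod_cast (by omega : N ≠ 0)
      have := Int.emod_nonneg (-(s * a)) hN0
      refine ⟨((-(s * a)) % N).toNat, -((-(s * a)) / N), ?_⟩
      rw [Int.toNat_of_nonneg this]
      have := Int.emod_add_mul_ediv (-(s * a)) N
      linear_combination this
    obtain ⟨r, hr⟩ := pow_expand (w * N ^ k * u') i
    obtain ⟨r2, hr2⟩ := pow_expand (w * u) j
    obtain ⟨w', hw'⟩ := hw
    refine ⟨j + N ^ k * i, ?_⟩
    have hpow : (1 + w * u) ^ (j + N ^ k * i) = (1 + w * u) ^ j *
        (1 + i * (w * N ^ k * u') + w * N ^ k * u' * (w * N ^ k * u') * r) := by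
      rw [pow_add, pow_mul, h, hr]
    rw [hpow]
    set Hj := (1 + w * u) ^ j with hHj
    have hz' : Hj = z + w * N ^ k * s := by linear_combination hs
    have hHj1 : Hj = 1 + N * (w' * u * (j + w * u * r2)) := by
      rw [hr2]
      linear_combination (j * u + w * u * u * r2) * hw'
    set g := w' * u * (j + w * u * r2)
    refine ⟨s * b + l * u' + g * i * u' + Hj * w' * N ^ k * u' * u' * r, ?_⟩
    have : Hj * (1 + i * (w * N ^ k * u') + w * N ^ k * u' * (w * N ^ k * u') * r) - z
        = (Hj - z) + (Hj - 1) * (i * (w * N ^ k * u')) + i * (w * N ^ k * u')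
          + Hj * (w * N ^ k * u' * (w * N ^ k * u') * r) := by ring
    rw [this]
    have e1 : Hj - 1 = N * g := by linear_combination hHj1
    have e2 : Hj - z = w * N ^ k * s := hs
    rw [e1, e2, pow_succ]
    linear_combination (w * N ^ k * u') * hi + (-(w * N ^ k * s)) * hab
      + Hj * w * N ^ k * u' * u' * N ^ k * r * hw'

end Ints
end RQ

namespace RQ
section Quad
open QuadraticAlgebra
variable {c t : ℤ}

lemma cast_norm (z : QuadraticAlgebra ℤ c t) :
    ((QuadraticAlgebra.norm z : ℤ) : QuadraticAlgebra ℤ c t) = z * star z := by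
  ext <;> simp [norm_def] <;> ring

lemma cast_dvd {a b : ℤ} (h : (a : QuadraticAlgebra ℤ c t) ∣ b) : a ∣ b := by
  obtain ⟨z, hz⟩ := h
  refine ⟨z.re, ?_⟩
  have := congrArg QuadraticAlgebra.re hz
  simpa using this

lemma cast_dvd' {a b : ℤ} (h : a ∣ b) : (a : QuadraticAlgebra ℤ c t) ∣ b := by
  obtain ⟨z, hz⟩ := h
  exact ⟨z, by rw [hz]; push_cast; rfl⟩

lemma cast_coprime {a b : ℤ} (h : IsCoprime a b) :
    IsCoprime (a : QuadraticAlgebra ℤ c t) b := by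
  obtain ⟨u, v, huv⟩ := h
  exact ⟨u, v, by exact_mod_cast congrArg (Int.cast : ℤ → QuadraticAlgebra ℤ c t) huv⟩

/-- the square root of the discriminant -/
def theta (c t : ℤ) : QuadraticAlgebra ℤ c t := ⟨-t, 2⟩

lemma theta_sq : theta c t * theta c t = ((t * t + 4 * c : ℤ) : QuadraticAlgebra ℤ c t) := by
  ext <;> simp [theta] <;> ring

lemma star_cast (n : ℤ) : star (n : QuadraticAlgebra ℤ c t) = n := by
  ext <;> simp

lemma star_dvd {a b : QuadraticAlgebra ℤ c t} (h : a ∣ b) : star a ∣ star b := by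
  obtain ⟨z, rfl⟩ := h
  exact ⟨star z, by rw [star_mul, mul_comm]⟩

/-- Assumptions on `b` used in the unit lemma. -/
lemma comax {b : QuadraticAlgebra ℤ c t}
    (h : IsCoprime (QuadraticAlgebra.norm b) (b.im * b.im * (t * t + 4 * c))) :
    IsCoprime b (star b) := by
  obtain ⟨u, v, huv⟩ := h
  have h1 := congrArg (Int.cast : ℤ → QuadraticAlgebra ℤ c t) huv
  push_cast at h1
  have h2 : b - star b = b.im * theta c t := by
    ext <;> simp [theta] <;> ring
  have h3 := theta_sq (c := c) (t := t)
  push_cast at h3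
  rw [cast_norm, ← h3] at h1
  refine ⟨u * star b + v * (b - star b), - v * (b - star b), ?_⟩
  rw [h2]
  have h4 : (b.im : QuadraticAlgebra ℤ c t) * theta c t = b - star b := h2.symm
  linear_combination h1 + (v : QuadraticAlgebra ℤ c t) * (b.im * theta c t) * h2

lemma exists_int_mod {b : QuadraticAlgebra ℤ c t} (hb : IsCoprime b (star b)) (M : ℕ)
    (z : QuadraticAlgebra ℤ c t) : ∃ H : ℤ, b ^ M ∣ z - H := by
  obtain ⟨u, v, huv⟩ := hb.pow (m := M) (n := M)
  set g := z * v * (star b) ^ M with hg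
  refine ⟨2 * g.re + t * g.im, ?_⟩
  have h1 : ((2 * g.re + t * g.im : ℤ) : QuadraticAlgebra ℤ c t) = g + star g := by
    ext <;> simp <;> ring
  have h2 : star g = star (z * v) * b ^ M := by
    rw [hg, star_mul, star_pow, star_star, mul_comm]
  rw [h1, h2, hg]
  exact ⟨z * u - star (z * v), by linear_combination (-z) * huv⟩

lemma int_dvd_of_pow_dvd {b : QuadraticAlgebra ℤ c t} (hb : IsCoprime b (star b)) (M : ℕ)
    {g : ℤ} (h : b ^ M ∣ (g : QuadraticAlgebra ℤ c t)) : (QuadraticAlgebra.norm b) ^ M ∣ g := by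
  have h1 := star_dvd h
  rw [star_cast, star_pow] at h1
  have h2 := (hb.pow (m := M) (n := M)).mul_dvd h h1
  rw [← mul_pow, ← cast_norm] at h2
  apply cast_dvd (c := c) (t := t)
  push_cast
  exact h2

lemma pow_dvd_of_int_dvd {b : QuadraticAlgebra ℤ c t} (M : ℕ)
    {g : ℤ} (h : (QuadraticAlgebra.norm b) ^ M ∣ g) : b ^ M ∣ (g : QuadraticAlgebra ℤ c t) := by
  have h1 := cast_dvd' (c := c) (t := t) h
  push_cast at h1
  rw [cast_norm, mul_pow] at h1
  exact (dvd_mul_right _ _).trans h1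

lemma dvd_pow_self_of {N : ℕ} (M : ℕ) : ∀ w : ℕ, w ∣ N ^ M → 0 < w → w ∣ N ^ w := by
  intro w
  induction w using Nat.strong_induction_on with
  | _ w ih =>
    intro h hw
    by_cases h1 : w = 1
    · subst h1; simp
    have hg : w.gcd N ≠ 1 := by
      intro hg
      have h2 : w.Coprime (N ^ M) := Nat.Coprime.pow_right M hg
      exact h1 (h2.eq_one_of_dvd h)
    obtain ⟨w', hw'⟩ := Nat.gcd_dvd_left w N
    set g := w.gcd N
    have hg0 : 0 < g := Nat.gcd_pos_of_pos_left _ hw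
    have hw'0 : 0 < w' := by
      rcases Nat.eq_zero_or_pos w' with h0 | h0
      · subst h0; omega
      · exact h0
    have hlt : w' < w := by
      have : 2 ≤ g := by omega
      nlinarith
    have h3 := ih w' hlt ((Dvd.intro_left g hw'.symm).trans h) hw'0
    have h4 : w ∣ N * N ^ w' := by
      rw [hw']
      exact mul_dvd_mul (Nat.gcd_dvd_right w N) h3
    rw [← pow_succ'] at h4
    exact h4.trans (pow_dvd_pow _ hlt)

lemma pell_pow {Δ : ℤ} {θ : QuadraticAlgebra ℤ c t} (hθ : θ * θ = Δ) (hΔ : 0 < Δ) {X Y : ℤ}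
    (hX : 0 < X) (hY : 0 < Y) (h : X ^ 2 - Δ * Y ^ 2 = 1) (k : ℕ) :
    ∃ X' Y' : ℤ, 0 < X' ∧ 0 < Y' ∧ X' ^ 2 - Δ * Y' ^ 2 = 1 ∧
      ((X : QuadraticAlgebra ℤ c t) + Y * θ) ^ (k + 1) = X' + Y' * θ := by
  induction k with
  | zero => exact ⟨X, Y, hX, hY, h, by simp⟩
  | succ k ih =>
    obtain ⟨X', Y', h1, h2, h3, h4⟩ := ih
    refine ⟨X' * X + Δ * (Y' * Y), X' * Y + Y' * X, by positivity, by positivity, ?_, ?_⟩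
    · linear_combination (X ^ 2 - Δ * Y ^ 2) * h3 + h
    · rw [pow_succ, h4]
      push_cast
      linear_combination ((Y' : QuadraticAlgebra ℤ c t) * Y) * hθ

lemma unit_lemma {b : QuadraticAlgebra ℤ c t} (hΔ : 0 < t * t + 4 * c)
    (hsq : ¬ IsSquare (t * t + 4 * c)) (hb : IsCoprime b (star b))
    (hN : Odd (QuadraticAlgebra.norm b).natAbs) :
    ∃ s : ℕ, ∀ p p' : ℤ, IsCoprime p (QuadraticAlgebra.norm b) →
      (QuadraticAlgebra.norm b) ^ s ∣ p - p' → ∀ m : ℕ,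
      ∃ e : QuadraticAlgebra ℤ c t, IsUnit e ∧ b ^ m ∣ e * p - p' := by
  set B := QuadraticAlgebra.norm b with hB
  set N := B.natAbs with hNB
  obtain ⟨X0, Y0, hXY, hY0⟩ := Pell.exists_of_not_isSquare hΔ hsq
  obtain ⟨X, Y, hX, hY, hXY⟩ : ∃ X Y : ℤ, 0 < X ∧ 0 < Y ∧ X ^ 2 - (t * t + 4 * c) * Y ^ 2 = 1 := by
    refine ⟨|X0|, |Y0|, ?_, abs_pos.2 hY0, by rw [sq_abs, sq_abs]; exact hXY⟩
    rw [abs_pos]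
    rintro rfl
    nlinarith [sq_nonneg Y0]
  set Δ := t * t + 4 * c with hΔd
  have hth := theta_sq (c := c) (t := t)
  set θ := theta c t with hθd
  set ε : QuadraticAlgebra ℤ c t := X + Y * θ with hε
  set ε' : QuadraticAlgebra ℤ c t := X - Y * θ with hε'
  have hεε : ε * ε' = 1 := by
    have := congrArg (Int.cast : ℤ → QuadraticAlgebra ℤ c t) hXY
    push_cast at this
    rw [hε, hε']
    push_cast at hth
    rw [hΔd] at this
    push_cast at this
    linear_combination this - (Y : QuadraticAlgebra ℤ c t) * Y * hth
  have hεu : IsUnit ε := IsUnit.of_mul_eq_one _ hεε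
  obtain ⟨e, he⟩ := exists_int_mod hb 1 ε
  obtain ⟨e', he'⟩ := exists_int_mod hb 1 ε'
  have hee : B ∣ e * e' - 1 := by
    have : b ^ 1 ∣ ((e * e' - 1 : ℤ) : QuadraticAlgebra ℤ c t) := by
      obtain ⟨q, hq⟩ := he
      obtain ⟨q', hq'⟩ := he'
      refine ⟨-(q * ε' + e * q'), ?_⟩
      push_cast
      linear_combination hεε - ε' * hq - e * hq'
    simpa using int_dvd_of_pow_dvd hb 1 this
  have hN0 : N ≠ 0 := by
    rintro h; rw [h] at hN; simp at hN
  have heN : IsCoprime e (N : ℤ) := by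
    obtain ⟨q, hq⟩ := Int.natAbs_dvd.2 hee
    exact ⟨e', -q, by rw [hNB]; linear_combination hq⟩
  obtain ⟨r, hr⟩ : ∃ r : ℕ, (N : ℤ) ∣ e ^ (r + 1) - 1 := by
    have hu := Int.isCoprime_iff_gcd_eq_one.1 heN
    have hφ : 0 < N.totient := Nat.totient_pos.2 (Nat.pos_of_ne_zero hN0)
    refine ⟨N.totient - 1, ?_⟩
    rw [Nat.sub_add_cancel hφ]
    obtain ⟨u, hu⟩ := (ZMod.coe_int_isUnit_iff_isCoprime e N).2 heN.symm
    have h1 := congrArg (Units.val) (ZMod.pow_totient u)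
    rw [← ZMod.intCast_zmod_eq_zero_iff_dvd]
    push_cast
    rw [← hu]
    rw [Units.val_pow_eq_pow_val, Units.val_one] at h1
    rw [h1, sub_self]
  set h := ε ^ (r + 1) with hh
  have hBN : ∀ k : ℕ, (N : ℤ) ^ k ∣ B ^ k ∧ B ^ k ∣ (N : ℤ) ^ k := fun k =>
    ⟨pow_dvd_pow_of_dvd (Int.natAbs_dvd.2 dvd_rfl) k, pow_dvd_pow_of_dvd (Int.dvd_natAbs.2 dvd_rfl) k⟩
  have hb1 : b ^ 1 ∣ h - 1 := by
    have h1 := he.trans (sub_dvd_pow_sub_pow ε (e : QuadraticAlgebra ℤ c t) (r + 1))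
    have h2 := pow_dvd_of_int_dvd (b := b) 1 (g := e ^ (r + 1) - 1)
      (((hBN 1).2).trans (by simpa using hr))
    have h3 := dvd_add h1 h2
    push_cast at h3
    rwa [sub_add_sub_cancel] at h3
  obtain ⟨X', Y', hX', hY', hXY', hpow⟩ := pell_pow (c := c) (t := t) hth hΔ hX hY hXY r
  set W : ℤ := 2 - 2 * X' with hW
  have hW0 : W ≠ 0 := by
    have : 1 < X' := by
      by_contra hlt
      have : X' = 1 := by omega
      subst this
      nlinarith [mul_pos hΔ (pow_pos hY' 2)]
    omega
  have hWh : ((X' : QuadraticAlgebra ℤ c t) - Y' * θ - 1) * (h - 1) = W := by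
    have := congrArg (Int.cast : ℤ → QuadraticAlgebra ℤ c t) hXY'
    push_cast at this hth
    rw [hh, hε, hpow, hW]
    push_cast
    linear_combination this - (Y' : QuadraticAlgebra ℤ c t) * Y' * hth
  refine ⟨W.natAbs, fun p p' hp hpp m => ?_⟩
  set M := m + W.natAbs with hM
  obtain ⟨H, hH⟩ := exists_int_mod hb M h
  have hMpos : 1 ≤ M := by omega
  have hNH : (N : ℤ) ∣ H - 1 := by
    have h1 : b ^ 1 ∣ ((H - 1 : ℤ) : QuadraticAlgebra ℤ c t) := by
      have := dvd_sub hb1 ((pow_dvd_pow b hMpos).trans hH)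
      push_cast
      rwa [sub_sub_sub_cancel_left] at this
    have h2 := int_dvd_of_pow_dvd hb 1 h1
    rw [pow_one] at h2
    exact Int.natAbs_dvd.2 h2
  set w := (H - 1).gcd ((N : ℤ) ^ M) with hw
  have hw1 : (w : ℤ) ∣ H - 1 := Int.gcd_dvd_left _ _
  have hw2 : (w : ℤ) ∣ (N : ℤ) ^ M := Int.gcd_dvd_right _ _
  have hNw : (N : ℤ) ∣ w := Int.dvd_coe_gcd hNH (dvd_pow_self _ (by omega))
  have hwpos : 0 < w := by
    apply Int.gcd_pos_of_ne_zero_right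
    exact pow_ne_zero _ (by exact_mod_cast hN0)
  have hwW : (w : ℤ) ∣ W := by
    apply cast_dvd (c := c) (t := t)
    have hwB := cast_dvd' (c := c) (t := t) (hw2.trans (hBN M).1)
    push_cast at hwB
    rw [hB, cast_norm, mul_pow] at hwB
    have h1 : ((w : ℤ) : QuadraticAlgebra ℤ c t) ∣ W * star b ^ M := by
      obtain ⟨q, hq⟩ := hH
      have h2 := cast_dvd' (c := c) (t := t) hw1
      push_cast at h2
      rw [← hWh]
      have e1 : ((X' : QuadraticAlgebra ℤ c t) - Y' * θ - 1) * (h - 1) * star b ^ M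
        = (X' - Y' * θ - 1) * star b ^ M * (H - 1) + (X' - Y' * θ - 1) * q * (b ^ M * star b ^ M) := by
        linear_combination ((X' : QuadraticAlgebra ℤ c t) - Y' * θ - 1) * star b ^ M * hq
      rw [e1]
      push_cast
      exact dvd_add (h2.mul_left _) (hwB.mul_left _)
    have h1' := star_dvd h1
    rw [star_mul, star_pow, star_star, star_cast, star_cast] at h1'
    obtain ⟨u, v, huv⟩ := hb.pow (m := M) (n := M)
    have e2 : (W : QuadraticAlgebra ℤ c t) = u * (b ^ M * W) + v * (W * star b ^ M) := by
      linear_combination (-(W : QuadraticAlgebra ℤ c t)) * huv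
    rw [e2]
    exact dvd_add (h1'.mul_left _) (h1.mul_left _)
  have hwle : w ≤ W.natAbs := Nat.le_of_dvd (Int.natAbs_pos.2 hW0) (Int.natCast_dvd.1 hwW)
  have hws : (w : ℤ) ∣ B ^ W.natAbs := by
    have h1 : w ∣ N ^ M := by exact_mod_cast hw2
    have h2 := (dvd_pow_self_of M w h1 hwpos).trans (pow_dvd_pow N hwle)
    have h3 : (w : ℤ) ∣ (N : ℤ) ^ W.natAbs := by exact_mod_cast h2
    exact h3.trans (hBN _).1
  obtain ⟨u, hu⟩ := hw1
  obtain ⟨v, hv⟩ := hw2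
  have huv : IsCoprime u v := by
    have hbez := Int.gcd_eq_gcd_ab (H - 1) ((N : ℤ) ^ M)
    rw [← hw] at hbez
    refine ⟨(H - 1).gcdA ((N : ℤ) ^ M), (H - 1).gcdB ((N : ℤ) ^ M), ?_⟩
    have hw0 : (w : ℤ) ≠ 0 := by exact_mod_cast hwpos.ne'
    apply mul_left_cancel₀ hw0
    linear_combination -hbez - (H - 1).gcdA ((N : ℤ) ^ M) * hu - (H - 1).gcdB ((N : ℤ) ^ M) * hv
  have huN : IsCoprime u (N : ℤ) := by
    refine icop fun l hl h1 h2 => ?_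
    have h3 : IsCoprime ((l : ℤ) ^ M) v := (huv.of_isCoprime_of_dvd_left h1).pow_left
    have h4 : (l : ℤ) ^ M ∣ w * v := by rw [← hv]; exact pow_dvd_pow_of_dvd h2 M
    have h5 := (h3.dvd_of_dvd_mul_right h4).trans hwW
    have h6 : l ^ M ∣ W.natAbs := by
      apply Int.natCast_dvd.1
      exact_mod_cast h5
    have h7 := Nat.le_of_dvd (Int.natAbs_pos.2 hW0) h6
    have h8 : M < l ^ M := Nat.lt_pow_self hl.one_lt
    omega
  obtain ⟨p1, q1, hpq⟩ := hp.pow_right (n := M)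
  have hz : (w : ℤ) ∣ p' * p1 - 1 := by
    have h1 : (w : ℤ) ∣ B ^ M := hws.trans (pow_dvd_pow _ (by omega))
    have h2 := hws.trans hpp
    have e1 : p' * p1 - 1 = -(p1 * (p - p')) - q1 * B ^ M := by linear_combination hpq
    rw [e1]
    exact dvd_sub ((h2.mul_left _).neg_right) (h1.mul_left _)
  obtain ⟨j, hj⟩ := hit hN (by exact_mod_cast hwpos.ne' : (w : ℤ) ≠ 0) hNw huN (p' * p1) hz M
  refine ⟨h ^ j, (hεu.pow _).pow _, ?_⟩
  refine (pow_dvd_pow b (by omega : m ≤ M)).trans ?_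
  have a1 := hH.trans (sub_dvd_pow_sub_pow h (H : QuadraticAlgebra ℤ c t) j)
  have a2 := pow_dvd_of_int_dvd (b := b) M (g := H ^ j * p - p') (by
    have h1 : B ^ M ∣ H ^ j - p' * p1 := by
      have : (1 + (w : ℤ) * u) = H := by linear_combination -hu
      rw [this] at hj
      exact (hBN M).2.trans ((dvd_mul_left _ _).trans hj)
    have e1 : H ^ j * p - p' = p * (H ^ j - p' * p1) - p' * q1 * B ^ M := by
      linear_combination p' * hpq
    rw [e1]
    exact dvd_sub (h1.mul_left _) (dvd_mul_left _ _))
  have a3 := dvd_add (a1.mul_left (p : QuadraticAlgebra ℤ c t)) a2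
  push_cast at a3
  have e3 : (p : QuadraticAlgebra ℤ c t) * (h ^ j - H ^ j) + (H ^ j * p - p') = h ^ j * p - p' := by
    ring
  rwa [e3] at a3

end Quad
end RQ

namespace RQ
section NT
open QuadraticAlgebra
variable {c t : ℤ}

lemma delta_pow {D : ℤ} (hD : 0 < D) {p : ℕ} (hp : p.Prime) (h : 4 * D ∣ p + 1) :
    (p : ℤ) ∣ D ^ (p / 2) - 1 := by
  have := Fact.mk hp
  lift D to ℕ using hD.le
  have hD' : 0 < D := by exact_mod_cast hD
  have h' : 4 * D ∣ p + 1 := by exact_mod_cast h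
  obtain ⟨l, hl⟩ := h'
  have hl0 : l ≠ 0 := by rintro rfl; omega
  have hpodd : Odd p := by
    rw [Nat.odd_iff]
    have : p + 1 = 2 * (2 * (D * l)) := by rw [hl]; ring
    omega
  obtain ⟨l', rfl⟩ : ∃ l', l = l' + 1 := ⟨l - 1, by omega⟩
  have hpm : p % (4 * D) = 4 * D - 1 := by
    have : p = (4 * D - 1) + 4 * D * l' := by
      have : 4 * D * (l' + 1) = 4 * D * l' + 4 * D := by ring
      omega
    rw [this, Nat.add_mul_mod_self_left, Nat.mod_eq_of_lt (by omega)]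
  set e := 4 * D - 1 with he
  have hJ : jacobiSym D p = 1 := by
    rw [jacobiSym.mod_right _ hpodd, Int.natAbs_natCast, hpm]
    have h1 : jacobiSym ((2 : ℤ) * (2 * D)) e = 1 := by
      have : ((2 : ℤ) * (2 * D)) = 1 + e * 1 := by omega
      rw [jacobiSym.mod_left, this, Int.add_mul_emod_self_left, ← jacobiSym.mod_left,
        jacobiSym.one_left]
    rw [jacobiSym.mul_left, jacobiSym.mul_left] at h1
    have h2 : jacobiSym 2 e = 1 ∨ jacobiSym 2 e = -1 := by
      apply jacobiSym.eq_one_or_neg_one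
      rw [← Int.isCoprime_iff_gcd_eq_one]
      exact ⟨2 * D, -1, by omega⟩
    rcases h2 with h2 | h2 <;> rw [h2] at h1 <;> simpa using h1
  have h3 := legendreSym.eq_pow p D
  rw [jacobiSym.legendreSym.to_jacobiSym, hJ] at h3
  rw [← ZMod.intCast_zmod_eq_zero_iff_dvd]
  push_cast at h3 ⊢
  rw [← h3, sub_self]

lemma cancel_int {a q : ℤ} {z : QuadraticAlgebra ℤ c t} (h : IsCoprime a q)
    (hd : (q : QuadraticAlgebra ℤ c t) ∣ a * z) : (q : QuadraticAlgebra ℤ c t) ∣ z :=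
  (cast_coprime h).symm.dvd_of_dvd_mul_left hd

lemma int_frob {p : ℕ} (hp : p.Prime) (x : ℤ) : (p : ℤ) ∣ x ^ p - x := by
  have := Fact.mk hp
  rw [← ZMod.intCast_zmod_eq_zero_iff_dvd]
  push_cast
  rw [ZMod.pow_card, sub_self]

lemma frob {p : ℕ} (hp : p.Prime) (hodd : p % 2 = 1)
    (h : (p : ℤ) ∣ (t * t + 4 * c) ^ (p / 2) - 1) (b : QuadraticAlgebra ℤ c t) :
    ((p : ℤ) : QuadraticAlgebra ℤ c t) ∣ b ^ p - b := by
  set P : QuadraticAlgebra ℤ c t := ((p : ℤ) : QuadraticAlgebra ℤ c t) with hP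
  have hθ : P ∣ theta c t ^ p - theta c t := by
    have h1 := cast_dvd' (c := c) (t := t) h
    rw [Int.cast_sub, Int.cast_pow, ← theta_sq, Int.cast_one] at h1
    have e : theta c t ^ p - theta c t = theta c t * ((theta c t * theta c t) ^ (p / 2) - 1) := by
      have : p = 2 * (p / 2) + 1 := by omega
      conv_lhs => rw [this]
      ring
    rw [e]
    exact h1.mul_left _
  set u : ℤ := 2 * b.re + t * b.im with hu
  set v : ℤ := b.im with hv
  have h2b : (2 : QuadraticAlgebra ℤ c t) * b = u + v * theta c t := by
    have : (2 : QuadraticAlgebra ℤ c t) = ((2 : ℤ) : QuadraticAlgebra ℤ c t) := by norm_num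
    rw [this]
    ext <;> simp [theta, hu, hv] <;> ring
  obtain ⟨r, hr⟩ := exists_add_pow_prime_eq hp (u : QuadraticAlgebra ℤ c t) (v * theta c t)
  have d1 : P ∣ (u : QuadraticAlgebra ℤ c t) ^ p - u := by
    have := cast_dvd' (c := c) (t := t) (int_frob hp u)
    push_cast at this
    rw [hP]; push_cast; exact this
  have d2 : P ∣ (v : QuadraticAlgebra ℤ c t) ^ p - v := by
    have := cast_dvd' (c := c) (t := t) (int_frob hp v)
    push_cast at this
    rw [hP]; push_cast; exact this
  have d3 : P ∣ (2 : QuadraticAlgebra ℤ c t) ^ p - 2 := by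
    have := cast_dvd' (c := c) (t := t) (int_frob hp 2)
    push_cast at this
    rw [hP]; push_cast; exact this
  have h2p : IsCoprime (2 : ℤ) (p : ℤ) := ⟨-(p / 2 : ℕ), 1, by push_cast; omega⟩
  apply cancel_int h2p
  rw [← hP]
  have hPp : P = (p : QuadraticAlgebra ℤ c t) := by rw [hP]; push_cast; rfl
  have e : ((2 : ℤ) : QuadraticAlgebra ℤ c t) * (b ^ p - b)
      = -(b ^ p * ((2 : QuadraticAlgebra ℤ c t) ^ p - 2))
        + (((u : QuadraticAlgebra ℤ c t) ^ p - u) + v ^ p * (theta c t ^ p - theta c t)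
        + theta c t * ((v : QuadraticAlgebra ℤ c t) ^ p - v)
        + P * (u * (v * theta c t) * r)) := by
    have e2 : (2 : QuadraticAlgebra ℤ c t) ^ p * b ^ p = (u + v * theta c t) ^ p := by
      rw [← mul_pow, h2b]
    rw [hr] at e2
    rw [mul_pow] at e2
    rw [hPp]
    push_cast
    linear_combination e2 - h2b
  rw [e]
  exact dvd_add (d3.mul_left _).neg_right (dvd_add (dvd_add (dvd_add d1 (hθ.mul_left _))
    (d2.mul_left _)) (dvd_mul_right _ _))

lemma fermat {p : ℕ} (hp : p.Prime) (hodd : p % 2 = 1)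
    (h : (p : ℤ) ∣ (t * t + 4 * c) ^ (p / 2) - 1) (b : QuadraticAlgebra ℤ c t)
    (hb : IsCoprime (QuadraticAlgebra.norm b) (p : ℤ)) :
    ((p : ℤ) : QuadraticAlgebra ℤ c t) ∣ b ^ (p - 1) - 1 := by
  have h1 := frob hp hodd h b
  apply cancel_int hb
  rw [cast_norm]
  have e : b * star b * (b ^ (p - 1) - 1) = star b * (b ^ p - b) := by
    have : p = (p - 1) + 1 := by omega
    conv_rhs => rw [this]
    ring
  rw [e]
  exact h1.mul_left _

lemma half {q : ℕ} (hq : q.Prime) (hodd : q % 2 = 1) (b : QuadraticAlgebra ℤ c t)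
    (h1 : ((q : ℤ) : QuadraticAlgebra ℤ c t) ∣ b ^ (q - 1) - 1)
    (h2 : (q : ℤ) ∣ (QuadraticAlgebra.norm b) ^ (q / 2) - 1)
    (h3 : IsCoprime (t * t + 4 * c) (q : ℤ)) :
    ∃ τ : ℤ, IsUnit τ ∧ ((q : ℤ) : QuadraticAlgebra ℤ c t) ∣ b ^ (q / 2) - τ := by
  set P : QuadraticAlgebra ℤ c t := ((q : ℤ) : QuadraticAlgebra ℤ c t) with hP
  set β := b ^ (q / 2) with hβ
  have hb2 : P ∣ β * β - 1 := by
    have : β * β = b ^ (q - 1) := by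
      rw [hβ, ← pow_add]; congr 1; omega
    rw [this]; exact h1
  have hbs : P ∣ β * star β - 1 := by
    have := cast_dvd' (c := c) (t := t) h2
    rw [Int.cast_sub, Int.cast_pow, cast_norm, mul_pow, ← star_pow, Int.cast_one] at this
    exact this
  have hd : P ∣ β - star β := by
    have e : β - star β = β * (β * β - 1) - β * (β * star β - 1)
      - (β * β - 1) * (β - star β) := by ring
    rw [e]
    exact dvd_sub (dvd_sub (hb2.mul_left _) (hbs.mul_left _)) (hb2.mul_right _)
  have e2 : β - star β = β.im * theta c t := by
    ext <;> simp [theta] <;> ring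
  have him : (q : ℤ) ∣ β.im := by
    have h5 : P ∣ (((t * t + 4 * c) * β.im : ℤ) : QuadraticAlgebra ℤ c t) := by
      rw [Int.cast_mul, ← theta_sq]
      have e3 : theta c t * theta c t * β.im = theta c t * (β - star β) := by rw [e2]; ring
      rw [e3]; exact hd.mul_left _
    exact h3.symm.dvd_of_dvd_mul_left (cast_dvd h5)
  have hre : P ∣ β - (β.re : QuadraticAlgebra ℤ c t) := by
    obtain ⟨k, hk⟩ := him
    refine ⟨⟨0, k⟩, ?_⟩
    ext <;> simp [hP, hk]
  have hrr : (q : ℤ) ∣ β.re * β.re - 1 := by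
    apply cast_dvd (c := c) (t := t)
    push_cast
    have e4 : (β.re : QuadraticAlgebra ℤ c t) * β.re - 1 = (β * β - 1) - (β - β.re) * (β + β.re) := by
      ring
    rw [e4]
    exact dvd_sub (by simpa [hP] using hb2) (by simpa [hP] using hre.mul_right _)
  have e5 : β.re * β.re - 1 = (β.re - 1) * (β.re + 1) := by ring
  rw [e5] at hrr
  rcases (Nat.prime_iff_prime_int.1 hq).dvd_or_dvd hrr with h6 | h6
  · refine ⟨1, isUnit_one, ?_⟩
    have := dvd_add hre (cast_dvd' (c := c) (t := t) h6)
    push_cast at this ⊢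
    rwa [sub_add_sub_cancel] at this
  · refine ⟨-1, isUnit_one.neg, ?_⟩
    have := dvd_add hre (cast_dvd' (c := c) (t := t) h6)
    push_cast at this ⊢
    have e7 : β - (β.re : QuadraticAlgebra ℤ c t) + (β.re + 1) = β - -1 := by ring
    rwa [e7] at this

lemma sigma {B n : ℤ} (hB : B.natAbs % 4 = 3) (hn : IsCoprime n B) :
    ∃ σ : ℤ, IsUnit σ ∧ ∀ q : ℕ, q.Prime → q % 4 = 3 → B ∣ q - σ * n →
      (q : ℤ) ∣ B ^ (q / 2) - 1 := by
  set N := B.natAbs with hN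
  have hJn : jacobiSym n N = 1 ∨ jacobiSym n N = -1 := by
    apply jacobiSym.eq_one_or_neg_one
    rw [← Int.isCoprime_iff_gcd_eq_one]
    rw [hN]
    obtain ⟨u, v, huv⟩ := hn
    exact ⟨u, v * B.sign, by rw [mul_assoc, Int.sign_mul_natAbs]; exact huv⟩
  have hm1 : ∀ m : ℕ, m % 4 = 3 → jacobiSym (-1) m = -1 := by
    intro m hm
    rw [jacobiSym.at_neg_one (by rw [Nat.odd_iff]; omega), ZMod.χ₄_nat_three_mod_four hm]
  have gen : ∀ q : ℕ, q.Prime → jacobiSym B q = 1 → (q : ℤ) ∣ B ^ (q / 2) - 1 := by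
    intro q hq hJ
    have := Fact.mk hq
    have h3 := legendreSym.eq_pow q B
    rw [jacobiSym.legendreSym.to_jacobiSym, hJ] at h3
    rw [← ZMod.intCast_zmod_eq_zero_iff_dvd]
    push_cast at h3 ⊢
    rw [← h3, sub_self]
  obtain ⟨η, hη, hBη, hJB⟩ : ∃ η : ℤ, (η = 1 ∨ η = -1) ∧ B = η * N ∧
      ∀ q : ℕ, q % 4 = 3 → jacobiSym B q = η * jacobiSym N q := by
    rcases Int.natAbs_eq B with h | h
    · exact ⟨1, Or.inl rfl, by rw [one_mul]; exact h, fun q _ => by rw [one_mul]; rw [← h]⟩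
    · refine ⟨-1, Or.inr rfl, by rw [neg_one_mul]; exact h, fun q hq => ?_⟩
      conv_lhs => rw [h, ← neg_one_mul, jacobiSym.mul_left, hm1 q hq]
  have main : ∀ (σ : ℤ) (q : ℕ), q.Prime → q % 4 = 3 → B ∣ q - σ * n →
      jacobiSym B q = - η * (jacobiSym σ N * jacobiSym n N) := by
    intro σ q hq hq4 hd
    rw [hJB q hq4, jacobiSym.quadratic_reciprocity_three_mod_four hB hq4, ← jacobiSym.mul_left,
      jacobiSym.mod_left (q : ℤ) N, jacobiSym.mod_left (σ * n) N]
    have : (q : ℤ) % N = (σ * n) % N :=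
      Int.emod_eq_emod_iff_emod_sub_eq_zero.2 (Int.emod_eq_zero_of_dvd (Int.natAbs_dvd.2 hd))
    rw [this]; ring
  by_cases hs : η * jacobiSym n N = -1
  · refine ⟨1, isUnit_one, fun q hq hq4 hd => gen q hq ?_⟩
    rw [main 1 q hq hq4 hd, jacobiSym.one_left]
    linear_combination -hs
  · refine ⟨-1, isUnit_one.neg, fun q hq hq4 hd => gen q hq ?_⟩
    rw [main (-1) q hq hq4 hd, hm1 N hB]
    rcases hη with h | h <;> rcases hJn with h' | h' <;> rw [h, h'] at hs ⊢ <;>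
      omega

lemma dir {A C : ℕ} (hA : A ≠ 0) (hC : C ≠ 0) (h : IsCoprime (A : ℤ) C) {a : ℤ}
    (ha : IsCoprime a A) : ∃ p : ℕ, p.Prime ∧ (A : ℤ) ∣ p - a ∧ (C : ℤ) ∣ p + 1 := by
  obtain ⟨u, v, huv⟩ := h
  set x : ℤ := a * (v * C) - u * A with hx
  have h1 : (A : ℤ) ∣ x - a := ⟨-(a * u) - u, by rw [hx]; linear_combination a * huv⟩
  have h2 : (C : ℤ) ∣ x + 1 := ⟨a * v + v, by rw [hx]; linear_combination -huv⟩
  have c1 : IsCoprime x A := coprime_congr h1 ha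
  have c2 : IsCoprime x C := by
    obtain ⟨k, hk⟩ := h2
    exact ⟨-1, k, by linear_combination -hk⟩
  obtain ⟨p, -, hp, hmod⟩ := Nat.forall_exists_prime_gt_and_zmodEq 0 (q := A * C) (a := x)
    (mul_ne_zero hA hC) (by push_cast; exact c1.mul_right c2)
  have hd := hmod.symm.dvd
  push_cast at hd
  refine ⟨p, hp, ?_, ?_⟩
  · have := dvd_add ((dvd_mul_right _ _).trans hd) h1
    rwa [sub_add_sub_cancel] at this
  · have := dvd_add ((dvd_mul_left _ _).trans hd) h2
    rwa [← add_assoc, sub_add_cancel] at this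

lemma reach_good {b : QuadraticAlgebra ℤ c t} {n : ℤ} (hΔ : 0 < t * t + 4 * c)
    (hsq : ¬ IsSquare (t * t + 4 * c)) (hb : IsCoprime b (star b))
    (hN : (QuadraticAlgebra.norm b).natAbs % 4 = 3)
    (hBΔ : IsCoprime (QuadraticAlgebra.norm b) (t * t + 4 * c))
    (hBn : IsCoprime (QuadraticAlgebra.norm b) n)
    (hBn1 : IsCoprime (QuadraticAlgebra.norm b) (n * n - 1)) :
    Reach (n : QuadraticAlgebra ℤ c t) b := by
  set B := QuadraticAlgebra.norm b with hB
  set N := B.natAbs with hNd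
  set Δ := t * t + 4 * c with hΔd
  have hNodd : Odd N := by rw [Nat.odd_iff]; omega
  obtain ⟨s0, hs0⟩ := unit_lemma hΔ hsq hb hNodd
  obtain ⟨σ, hσ, hσq⟩ := sigma hN hBn.symm
  have hσσ : σ * σ = 1 := by
    rcases Int.isUnit_iff.1 hσ with h | h <;> rw [h] <;> norm_num
  set s := s0 + 1 with hs
  have hBN : ∀ k : ℕ, (N : ℤ) ^ k ∣ B ^ k ∧ B ^ k ∣ (N : ℤ) ^ k := fun k =>
    ⟨pow_dvd_pow_of_dvd (Int.natAbs_dvd.2 dvd_rfl) k, pow_dvd_pow_of_dvd (Int.dvd_natAbs.2 dvd_rfl) k⟩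
  have hNB : (N : ℤ) ∣ B := Int.natAbs_dvd.2 dvd_rfl
  have hBN1 : B ∣ (N : ℤ) := Int.dvd_natAbs.2 dvd_rfl
  have hN0 : N ≠ 0 := by omega
  have hNs : N ^ s ≠ 0 := pow_ne_zero _ hN0
  have hNΔ : IsCoprime (N : ℤ) Δ := hBΔ.of_isCoprime_of_dvd_left hNB
  have hN4 : IsCoprime (N : ℤ) 4 := by
    have h2 : IsCoprime (N : ℤ) 2 := ⟨1, -(N / 2 : ℕ), by push_cast; omega⟩
    have := h2.mul_right h2
    norm_num at this
    exact this
  obtain ⟨D, hDΔ⟩ : ∃ D : ℕ, (D : ℤ) = Δ := ⟨Δ.toNat, Int.toNat_of_nonneg hΔ.le⟩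
  have hD0 : 0 < D := by omega
  have hσnN : IsCoprime (σ * n) (N : ℤ) := by
    refine IsCoprime.mul_left ?_ (hBn.of_isCoprime_of_dvd_left hNB).symm
    exact ⟨σ, 0, by rw [hσσ]; ring⟩
  have hσns : IsCoprime (σ * n) ((N ^ s : ℕ) : ℤ) := by
    push_cast
    exact hσnN.pow_right
  have facts : ∀ p : ℕ, p.Prime → ((N ^ s : ℕ) : ℤ) ∣ p - σ * n → 4 * Δ ∣ p + 1 →
      p % 4 = 3 ∧ IsCoprime (p : ℤ) B ∧ B ^ s ∣ p - σ * n ∧ B ∣ p - σ * n ∧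
      ((p : ℤ) : QuadraticAlgebra ℤ c t) ∣ b ^ (p - 1) - 1 := by
    intro p hp h1 h2
    have h4 : p % 4 = 3 := by
      have : (4 : ℤ) ∣ p + 1 := (dvd_mul_right _ _).trans h2
      omega
    push_cast at h1
    have h3 : B ^ s ∣ p - σ * n := (hBN s).2.trans h1
    have h5 : B ∣ p - σ * n := (dvd_pow_self B (by omega)).trans h3
    have h6 : IsCoprime (p : ℤ) B :=
      coprime_congr h5 (hσnN.of_isCoprime_of_dvd_right hBN1)
    exact ⟨h4, h6, h3, h5, fermat hp (by omega) (delta_pow hΔ hp h2) b h6.symm⟩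
  obtain ⟨p, hp, hp1, hp2⟩ := dir (A := N ^ s) (C := 4 * D) hNs (by omega)
    (by push_cast; rw [hDΔ]; exact (hN4.mul_right hNΔ).pow_left) hσns
  push_cast at hp2
  rw [hDΔ] at hp2
  obtain ⟨p4, pB, pBs, pB1, pF⟩ := facts p hp hp1 hp2
  set k := p / 2 with hk
  have hkN : IsCoprime (N : ℤ) k := by
    refine icop fun l hl h1 h2 => ?_
    have h3 : (l : ℤ) ∣ p - 1 := by
      have : (p : ℤ) - 1 = 2 * k := by omega
      rw [this]; exact h2.mul_left _
    have h4 : (l : ℤ) ∣ p - σ * n := (h1.trans hNB).trans pB1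
    refine icop_prime hBn1 hl (h1.trans hNB) ?_
    have e : n * n - 1 = (σ * n + 1) * ((p - 1) - (p - σ * n)) := by
      linear_combination (-(n * n)) * hσσ
    rw [e]
    exact (dvd_sub h3 h4).mul_left _
  obtain ⟨q, hq, hq1, hq2⟩ := dir (A := N ^ s) (C := 4 * D * k) hNs
    (by have : 0 < k := by omega
        positivity)
    (by push_cast; rw [hDΔ]; exact ((hN4.mul_right hNΔ).mul_right hkN).pow_left) hσns
  push_cast at hq2
  rw [hDΔ] at hq2
  obtain ⟨q4, qB, qBs, qB1, qF⟩ := facts q hq hq1 ((dvd_mul_right _ _).trans hq2)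
  have hqΔ : IsCoprime Δ (q : ℤ) := by
    obtain ⟨l, hl⟩ := hq2
    exact ⟨4 * k * l, -1, by linear_combination -hl⟩
  obtain ⟨τ, hτ, hτd⟩ := half hq (by omega) b qF (hσq q hq q4 qB1) hqΔ
  set k' := q / 2 with hk'
  have hkk : Nat.Coprime k' (2 * k) := by
    rw [← Nat.isCoprime_iff_coprime]
    obtain ⟨l, hl⟩ := hq2
    have e : 2 * ((k' : ℤ) + 1) = 2 * (2 * k * (Δ * l)) := by
      have : 2 * (k' : ℤ) + 1 = q := by omega
      linear_combination this + hl
    refine ⟨-1, Δ * l, ?_⟩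
    push_cast
    linarith
  obtain ⟨e, -, he⟩ := Nat.exists_mul_mod_eq_one_of_coprime hkk (by omega)
  set m := k' * e with hm
  have hbp : ((p : ℤ) : QuadraticAlgebra ℤ c t) ∣ b ^ m - b := by
    have hm' : m = 1 + (p - 1) * (m / (2 * k)) := by
      have h1 := Nat.mod_add_div m (2 * k)
      have h2 : p - 1 = 2 * k := by omega
      rw [h2]; omega
    have h1 := pF.trans (sub_dvd_pow_sub_pow (b ^ (p - 1)) 1 (m / (2 * k)))
    rw [one_pow, ← pow_mul] at h1
    rw [hm', pow_add, pow_one]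
    have := h1.mul_left b
    rwa [mul_sub, mul_one] at this
  have hbq : ((q : ℤ) : QuadraticAlgebra ℤ c t) ∣ b ^ m - ((τ ^ e : ℤ) : QuadraticAlgebra ℤ c t) := by
    have := hτd.trans (sub_dvd_pow_sub_pow (b ^ k') (τ : QuadraticAlgebra ℤ c t) e)
    rw [← pow_mul] at this
    push_cast
    push_cast at this
    exact this
  have hτu : IsUnit ((τ ^ e : ℤ) : QuadraticAlgebra ℤ c t) :=
    (hτ.pow e).map (Int.castRingHom (QuadraticAlgebra ℤ c t))
  have c1 : Reach ((q : ℤ) : QuadraticAlgebra ℤ c t) (b ^ m) := by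
    refine reach_of_dvd_sub ?_ (reach_swap (reach_of_unit hτu))
    rw [← dvd_neg, neg_sub]; exact hbq
  obtain ⟨ε, hε, hεd⟩ := hs0 p q pB (by
    have h1 := dvd_sub pBs qBs
    rw [sub_sub_sub_cancel_right] at h1
    exact (pow_dvd_pow B (by omega)).trans h1) m
  have c2 : Reach (ε * ((p : ℤ) : QuadraticAlgebra ℤ c t)) (b ^ m) := by
    refine reach_of_dvd_sub' ?_ c1
    rw [← dvd_neg, neg_sub]; exact hεd
  have c3 : Reach ((p : ℤ) : QuadraticAlgebra ℤ c t) (b ^ m) := (reach_unit_iff hε).1 c2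
  have c4 : Reach ((p : ℤ) : QuadraticAlgebra ℤ c t) b := reach_of_dvd_sub hbp c3
  have c5 : Reach ((σ * n : ℤ) : QuadraticAlgebra ℤ c t) b := by
    refine reach_of_dvd_sub' ?_ c4
    have := pow_dvd_of_int_dvd (b := b) 1 (g := p - σ * n) (by rw [pow_one]; exact pB1)
    rw [pow_one, Int.cast_sub] at this
    exact this
  rw [Int.cast_mul] at c5
  exact (reach_unit_iff (hσ.map (Int.castRingHom (QuadraticAlgebra ℤ c t)))).1 c5

end NT
end RQ

namespace RQ
section Red
open QuadraticAlgebra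
variable {c t : ℤ}

lemma reach_int (hc : 0 < c) (hsq : ¬ IsSquare (t * t + 4 * c)) {n : ℤ}
    {b : QuadraticAlgebra ℤ c t} (h : IsCoprime (n : QuadraticAlgebra ℤ c t) b) :
    Reach (n : QuadraticAlgebra ℤ c t) b := by
  have hΔ : 0 < t * t + 4 * c := by nlinarith [mul_self_nonneg t]
  by_cases hn0 : n = 0
  · subst hn0
    rw [Int.cast_zero, isCoprime_zero_left] at h
    exact reach_swap (reach_of_unit h)
  by_cases hnu : n * n - 1 = 0
  · exact reach_of_unit (IsUnit.of_mul_eq_one (n : QuadraticAlgebra ℤ c t) (by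
      rw [← Int.cast_mul, show n * n = 1 by linarith, Int.cast_one]))
  have h0 : IsCoprime (F c t b.re b.im) n := by
    obtain ⟨u, v, huv⟩ := h
    have e : v * b = 1 - u * n := by linear_combination huv
    have e2 := congrArg QuadraticAlgebra.norm e
    rw [map_mul, norm_def b, norm_def (1 - u * (n : QuadraticAlgebra ℤ c t))] at e2
    simp at e2
    refine ⟨QuadraticAlgebra.norm v, 2 * u.re - n * u.re * u.re + t * (1 - n * u.re) * u.im
      + c * n * u.im * u.im, ?_⟩
    unfold F
    linear_combination e2
  have hev : Even (n * ((t * t + 4 * c) * (n * n - 1))) := by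
    have e : n * ((t * t + 4 * c) * (n * n - 1)) = (n * (n + 1)) * ((t * t + 4 * c) * (n - 1)) := by
      ring
    rw [e]
    exact (Int.even_mul_succ_self n).mul_right _
  obtain ⟨x, y, hx, hy, hxy, hm, hn, h3⟩ := sign_pair hc t hn0 (mul_ne_zero hΔ.ne' hnu) hev h0
  set b' : QuadraticAlgebra ℤ c t := ⟨x, y⟩ with hb'
  have hB : QuadraticAlgebra.norm b' = F c t x y := by rw [norm_def]; rfl
  have hBΔ : IsCoprime (F c t x y) (t * t + 4 * c) := hm.of_mul_right_left
  have hBn1 : IsCoprime (F c t x y) (n * n - 1) := hm.of_mul_right_right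
  have hBy : IsCoprime (F c t x y) y := by
    have : IsCoprime (x * x + y * (t * x - c * y)) y := (hxy.mul_left hxy).add_mul_left_left _
    have e : F c t x y = x * x + y * (t * x - c * y) := by unfold F; ring
    rw [e]; exact this
  have hcm : IsCoprime b' (star b') := by
    apply comax
    rw [hB]
    exact (hBy.mul_right hBy).mul_right hBΔ
  have hgood : Reach (n : QuadraticAlgebra ℤ c t) b' := by
    apply reach_good hΔ hsq hcm <;> rw [hB] <;> assumption
  refine reach_of_dvd_sub ?_ hgood
  obtain ⟨p, hp⟩ := hx
  obtain ⟨q, hq⟩ := hy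
  refine ⟨⟨p, q⟩, ?_⟩
  ext <;> simp [hb', hp, hq]

lemma reach_all (hc : 0 < c) (hsq : ¬ IsSquare (t * t + 4 * c)) :
    ∀ (k : ℕ) (a b : QuadraticAlgebra ℤ c t), a.im.natAbs = k → IsCoprime a b → Reach a b := by
  intro k
  induction k using Nat.strong_induction_on with
  | _ k ih =>
    intro a b hk hab
    by_cases h0 : a.im = 0
    · have : a = ((a.re : ℤ) : QuadraticAlgebra ℤ c t) := by ext <;> simp [h0]
      rw [this] at hab ⊢
      exact reach_int hc hsq hab
    · set q := b.im / a.im with hq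
      set b' := b + a * ((-q : ℤ) : QuadraticAlgebra ℤ c t) with hb'
      have him : b'.im = b.im % a.im := by
        rw [Int.emod_def, hb', hq]
        simp
        ring
      have hlt : b'.im.natAbs < k := by
        have h1 := Int.emod_nonneg b.im h0
        have h2 := Int.emod_lt_abs b.im h0
        rw [Int.abs_eq_natAbs] at h2
        omega
      have hr := ih _ hlt b' a rfl (hab.add_mul_left_right _).symm
      refine reach_of_dvd_sub ?_ (reach_swap hr)
      rw [hb']
      exact ⟨((-q : ℤ) : QuadraticAlgebra ℤ c t), by ring⟩
end Red
end RQ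

namespace RQ
section Transfer
open QuadraticAlgebra

lemma exists_omega {R : Type*} [CommRing R] (e : Module.Basis (Fin 2) ℤ R) :
    ∃ om : R, (∀ z : R, ∃ X Y : ℤ, z = X + Y * om) ∧
      (∀ X Y : ℤ, (X : R) + Y * om = 0 → X = 0 ∧ Y = 0) := by
  have rep : ∀ z : R, z = (e.repr z 0 : ℤ) * e 0 + (e.repr z 1 : ℤ) * e 1 := by
    intro z
    have := e.sum_repr z
    rw [Fin.sum_univ_two, zsmul_eq_mul, zsmul_eq_mul] at this
    exact this.symm
  have ind : ∀ X Y : ℤ, (X : R) * e 0 + Y * e 1 = 0 → X = 0 ∧ Y = 0 := by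
    intro X Y h
    have h2 := Fintype.linearIndependent_iff.1 e.linearIndependent ![X, Y] (by
      rw [Fin.sum_univ_two, zsmul_eq_mul, zsmul_eq_mul]; simpa using h)
    exact ⟨by simpa using h2 0, by simpa using h2 1⟩
  set m := e.repr 1 0 with hm
  set n := e.repr 1 1 with hn
  have h1 : (1 : R) = m * e 0 + n * e 1 := rep 1
  have hcop : IsCoprime m n := by
    refine icop fun p hp ha hb => ?_
    obtain ⟨a, ha⟩ := ha
    obtain ⟨b, hb⟩ := hb
    set r := (a : R) * e 0 + b * e 1 with hr
    have hpr : ((p : ℤ) : R) * r = 1 := by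
      rw [h1, ha, hb, hr]; push_cast; ring
    have h3 := rep (r * e 0)
    have h4 := ind ((p : ℤ) * (e.repr (r * e 0) 0) - 1) ((p : ℤ) * (e.repr (r * e 0) 1)) (by
      push_cast at hpr ⊢
      linear_combination (-(p : R)) * h3 + e 0 * hpr)
    have h5 : (p : ℤ) ∣ 1 := ⟨e.repr (r * e 0) 0, by linarith [h4.1]⟩
    exact icop_prime isCoprime_one_left hp h5 h5
  obtain ⟨u, v, huv⟩ := hcop
  have huv' : (u : R) * m + v * n = 1 := by exact_mod_cast congrArg (Int.cast : ℤ → R) huv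
  refine ⟨-v * e 0 + u * e 1, fun z => ?_, fun X Y h => ?_⟩
  · set α := e.repr z 0
    set β := e.repr z 1
    refine ⟨u * α + v * β, m * β - n * α, ?_⟩
    have hz : z = α * e 0 + β * e 1 := rep z
    have h2 : ((u * α + v * β : ℤ) : R) = (u * α + v * β) * (m * e 0 + n * e 1) := by
      rw [← h1]; push_cast; ring
    rw [h2, hz]
    push_cast
    linear_combination (-(α * e 0 + β * e 1)) * huv'
  · have h2 : ((X * m - Y * v : ℤ) : R) * e 0 + ((X * n + Y * u : ℤ) : R) * e 1 = 0 := by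
      push_cast
      linear_combination h - X * h1
    obtain ⟨i, j⟩ := ind _ _ h2
    constructor
    · linear_combination u * i + v * j - X * huv
    · linear_combination m * j - n * i - Y * huv

lemma exists_equiv {R : Type*} [CommRing R] [IsDomain R] (e : Module.Basis (Fin 2) ℤ R)
    (ψ : R →+* ℝ) : ∃ c t : ℤ, 0 < c ∧ ¬ IsSquare (t * t + 4 * c) ∧
      Nonempty (R ≃+* QuadraticAlgebra ℤ c t) := by
  obtain ⟨om₀, hs₀, hi₀⟩ := exists_omega e
  obtain ⟨c₀, t₀, h₀⟩ := hs₀ (om₀ * om₀)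
  obtain ⟨om, c, t, ht, hs, hi, hom⟩ : ∃ (om : R) (c t : ℤ), (t = 0 ∨ t = 1) ∧
      (∀ z : R, ∃ X Y : ℤ, z = X + Y * om) ∧
      (∀ X Y : ℤ, (X : R) + Y * om = 0 → X = 0 ∧ Y = 0) ∧ om * om = c + t * om := by
    refine ⟨om₀ - (t₀ / 2 : ℤ), c₀ + t₀ * (t₀ / 2) - (t₀ / 2) * (t₀ / 2), t₀ - 2 * (t₀ / 2),
      by omega, fun z => ?_, fun X Y h => ?_, ?_⟩
    · obtain ⟨X, Y, h⟩ := hs₀ z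
      exact ⟨X + Y * (t₀ / 2 : ℤ), Y, by rw [h]; push_cast; ring⟩
    · obtain ⟨i, j⟩ := hi₀ (X - Y * (t₀ / 2 : ℤ)) Y (by push_cast; linear_combination h)
      subst j
      exact ⟨by simpa using i, rfl⟩
    · push_cast
      linear_combination h₀
  have hθ : ((2 * om - t : R)) * (2 * om - t) = ((t * t + 4 * c : ℤ) : R) := by
    push_cast
    linear_combination 4 * hom
  have hnn : 0 ≤ t * t + 4 * c := by
    have h1 := congrArg ψ hθ
    rw [map_mul, map_intCast] at h1
    have h2 : (0 : ℝ) ≤ ((t * t + 4 * c : ℤ) : ℝ) := by rw [← h1]; exact mul_self_nonneg _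
    exact_mod_cast h2
  have hsq : ¬ IsSquare (t * t + 4 * c) := by
    rintro ⟨r, hr⟩
    rw [hr] at hθ
    have h1 : (2 * om - t - r) * (2 * om - t + r) = 0 := by
      push_cast at hθ
      linear_combination hθ
    rcases mul_eq_zero.1 h1 with h2 | h2
    · have := (hi (-t - r) 2 (by push_cast; linear_combination h2)).2
      omega
    · have := (hi (-t + r) 2 (by push_cast; linear_combination h2)).2
      omega
  have hc : 0 < c := by
    rcases ht with rfl | rfl
    · rcases (show 0 ≤ c by omega).eq_or_lt with h | h
      · subst h; exact absurd ⟨0, by norm_num⟩ hsq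
      · exact h
    · rcases (show 0 ≤ c by omega).eq_or_lt with h | h
      · subst h; exact absurd ⟨1, by norm_num⟩ hsq
      · exact h
  refine ⟨c, t, hc, hsq, ?_⟩
  let f : QuadraticAlgebra ℤ c t →+* R :=
    { toFun := fun z => z.re + z.im * om
      map_one' := by simp
      map_zero' := by simp
      map_add' := by intro x y; simp; ring
      map_mul' := by
        intro x y
        simp
        linear_combination (-(x.im * y.im : R)) * hom }
  have hf : Function.Bijective f := by
    constructor
    · rw [injective_iff_map_eq_zero]
      intro z hz
      obtain ⟨i, j⟩ := hi z.re z.im hz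
      ext
      · exact i
      · exact j
    · intro z
      obtain ⟨X, Y, h⟩ := hs z
      exact ⟨⟨X, Y⟩, h.symm⟩
  exact ⟨(RingEquiv.ofBijective f hf).symm⟩

lemma finrank_two (d : ℕ) (hd : Squarefree d) (hd1 : 1 < d) :
    Module.finrank ℚ ℚ⟮(Real.sqrt d)⟯ = 2 := by
  have hmonic : (Polynomial.X ^ 2 - Polynomial.C (d : ℚ)).Monic :=
    Polynomial.monic_X_pow_sub_C _ (by norm_num)
  have hirr : Irreducible (Polynomial.X ^ 2 - Polynomial.C (d : ℚ)) := by
    apply X_pow_sub_C_irreducible_of_prime Nat.prime_two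
    intro b hb
    have h1 : IsSquare (d : ℚ) := ⟨b, by rw [← hb, sq]⟩
    rw [Rat.isSquare_natCast_iff] at h1
    obtain ⟨r, hr⟩ := h1
    have := Nat.isUnit_iff.1 (hd r ⟨1, by rw [hr, mul_one]⟩)
    subst this
    omega
  have hroot : Polynomial.aeval (Real.sqrt d) (Polynomial.X ^ 2 - Polynomial.C (d : ℚ)) = 0 := by
    simp
  have hmin := minpoly.eq_of_irreducible_of_monic hirr hroot hmonic
  have hinteg : IsIntegral ℚ (Real.sqrt d) := ⟨_, hmonic, by simpa [Polynomial.aeval_def] using hroot⟩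
  rw [IntermediateField.adjoin.finrank hinteg, ← hmin, Polynomial.natDegree_X_pow_sub_C]

end Transfer
end RQ

theorem stmt_10 (d : ℕ) (hd : Squarefree d) (hd1 : 1 < d)
    (K : IntermediateField ℚ ℝ) (hK : K = ℚ⟮(Real.sqrt d)⟯) [NumberField K]
    (M : Matrix (Fin 2) (Fin 2) (NumberField.RingOfIntegers K))
    (hsing : M.det = 0)
    (hprinc : (∃ i, (Ideal.span {M i 0, M i 1}).IsPrincipal) ∨
              (∃ j, (Ideal.span {M 0 j, M 1 j}).IsPrincipal)) :
    IsIdemProd M := by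
  have hfin : Module.finrank ℚ K = 2 := by
    rw [hK]; exact RQ.finrank_two d hd hd1
  have hfin' : Module.finrank ℤ (NumberField.RingOfIntegers K) = 2 := by
    rw [NumberField.RingOfIntegers.rank, hfin]
  let e := Module.finBasisOfFinrankEq ℤ (NumberField.RingOfIntegers K) hfin'
  let ψ : NumberField.RingOfIntegers K →+* ℝ :=
    (algebraMap K ℝ).comp (algebraMap (NumberField.RingOfIntegers K) K)
  obtain ⟨c, t, hc, hsq, ⟨E⟩⟩ := RQ.exists_equiv e ψ
  refine RQ.main_general (fun a b hab => ?_) M hsing hprinc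
  apply RQ.reach_ringEquiv E
  exact RQ.reach_all hc hsq _ _ _ rfl (hab.map E.toRingHom)
end
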